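/- arXiv:1705.01637 — 4 statements merged into one kernel-verified Lean document; each statement's English description precedes it below -/
import Mathlib

section
/- There exist constants C₀ > 0, C' = C₀ − 4 > 0 and Δ₀ such that the following holds. Let G = (V,E) be a finite simple graph with maximum degree Δ ≥ Δ₀ and minimum degree δ ≥ Δ/4, and let each edge e be assigned a finite list L_e with |L_e| = Δ + ⌊C₀·Δ^(1/2)·(log Δ)^4⌋. Then there exist sets R_v ⊆ ⋃_{e ∈ E(v)} L_e for each vertex v ∈ V such that for every edge e = uv: (i) |L_e ∩ R_u ∩ R_v| ≥ (1/2)·(log Δ)^8, and (ii) |L_e ∖ (R_u ∪ R_v)| ≥ Δ + C'·Δ^(1/2)·(log Δ)^4. -/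
/-- The points of `Ω` that lie in none of the events `A j` with `j ∈ S`. -/
def avoiding {Ω I : Type*} [Fintype Ω] [DecidableEq Ω] (A : I → Finset Ω) (S : Finset I) :
    Finset Ω :=
  Finset.univ.filter fun x => ∀ j ∈ S, x ∉ A j

theorem mem_avoiding {Ω I : Type*} [Fintype Ω] [DecidableEq Ω] {A : I → Finset Ω}
    {S : Finset I} {x : Ω} : x ∈ avoiding A S ↔ ∀ j ∈ S, x ∉ A j := by
  simp [avoiding]

/-- The inductive estimate behind the symmetric Lovász Local Lemma. -/
theorem card_inter_avoiding_le {Ω I : Type*} [Fintype Ω] [DecidableEq Ω] [DecidableEq I]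
    (A : I → Finset Ω) (Γ : I → Finset I) {p d : ℝ} (hp : 0 ≤ p)
    (hΓ : ∀ i, ((Γ i).card : ℝ) ≤ d) (hpd : 4 * p * d ≤ 1)
    (h : ∀ i T, Disjoint (Γ i) T →
      ((A i ∩ avoiding A T).card : ℝ) ≤ p * (avoiding A T).card) (S : Finset I) :
    ∀ i, ((A i ∩ avoiding A S).card : ℝ) ≤ 2 * p * (avoiding A S).card := by
  induction S using Finset.strongInduction with
  | H S ih =>
    intro i
    by_cases hS : Disjoint (Γ i) S
    · have := h i S hS
      have h0 : 0 ≤ p * (avoiding A S).card := by positivity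
      linarith
    · have hlt : S \ Γ i ⊂ S := by
        refine Finset.ssubset_iff_subset_ne.2 ⟨Finset.sdiff_subset, fun he => hS ?_⟩
        exact (Finset.sdiff_eq_self_iff_disjoint.1 he).symm
      set B := avoiding A (S \ Γ i) with hB
      have h1 : ((A i ∩ B).card : ℝ) ≤ p * B.card := h i _ Finset.disjoint_sdiff
      have h2 : ((A i ∩ avoiding A S).card : ℝ) ≤ (A i ∩ B).card := by
        refine Nat.cast_le.2 (Finset.card_le_card (Finset.inter_subset_inter_left ?_))
        intro x hx
        rw [hB, mem_avoiding]
        rw [mem_avoiding] at hx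
        exact fun j hj => hx j (Finset.sdiff_subset hj)
      have h3 : B ⊆ avoiding A S ∪ (Γ i).biUnion fun j => A j ∩ B := by
        intro x hx
        by_cases hxS : x ∈ avoiding A S
        · exact Finset.mem_union_left _ hxS
        · rw [mem_avoiding] at hxS
          push Not at hxS
          obtain ⟨j, hj, hxj⟩ := hxS
          refine Finset.mem_union_right _ (Finset.mem_biUnion.2 ⟨j, ?_, ?_⟩)
          · by_contra hjΓ
            exact mem_avoiding.1 hx j (Finset.mem_sdiff.2 ⟨hj, hjΓ⟩) hxj
          · exact Finset.mem_inter.2 ⟨hxj, hx⟩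
      have h4 : (B.card : ℝ) ≤ (avoiding A S).card + ∑ j ∈ Γ i, ((A j ∩ B).card : ℝ) := by
        have := (Finset.card_le_card h3).trans
          ((Finset.card_union_le _ _).trans (Nat.add_le_add_left Finset.card_biUnion_le _))
        exact_mod_cast this
      have h5 : ∑ j ∈ Γ i, ((A j ∩ B).card : ℝ) ≤ d * (2 * p * B.card) := by
        refine (Finset.sum_le_card_nsmul _ _ _ fun j _ => ih _ hlt j).trans ?_
        rw [nsmul_eq_mul]
        exact mul_le_mul_of_nonneg_right (hΓ i) (by positivity)
      have h6 : 4 * p * d * B.card ≤ 1 * B.card :=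
        mul_le_mul_of_nonneg_right hpd (by positivity)
      have h7 : (B.card : ℝ) ≤ 2 * (avoiding A S).card := by nlinarith
      nlinarith [mul_le_mul_of_nonneg_left h7 hp]

/-- The symmetric Lovász Local Lemma for the counting measure on a finite set, in its lopsided
form. -/
theorem avoiding_nonempty {Ω I : Type*} [Fintype Ω] [DecidableEq Ω] [Nonempty Ω]
    [DecidableEq I] (A : I → Finset Ω) (Γ : I → Finset I) {p d : ℝ} (hp : 0 ≤ p)
    (hp' : 2 * p < 1) (hΓ : ∀ i, ((Γ i).card : ℝ) ≤ d) (hpd : 4 * p * d ≤ 1)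
    (h : ∀ i T, Disjoint (Γ i) T →
      ((A i ∩ avoiding A T).card : ℝ) ≤ p * (avoiding A T).card) (S : Finset I) :
    (avoiding A S).Nonempty := by
  induction S using Finset.induction_on with
  | empty =>
    obtain ⟨x⟩ := ‹Nonempty Ω›
    exact ⟨x, by simp [mem_avoiding]⟩
  | insert i S _ ih =>
    by_contra hne
    have hsub : avoiding A S ⊆ A i ∩ avoiding A S := by
      intro x hx
      refine Finset.mem_inter.2 ⟨?_, hx⟩
      by_contra hxi
      refine hne ⟨x, mem_avoiding.2 fun j hj => ?_⟩
      rcases Finset.mem_insert.1 hj with rfl | hj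
      · exact hxi
      · exact mem_avoiding.1 hx j hj
    have h1 : ((avoiding A S).card : ℝ) ≤ (A i ∩ avoiding A S).card :=
      Nat.cast_le.2 (Finset.card_le_card hsub)
    have h2 := card_inter_avoiding_le A Γ hp hΓ hpd h S i
    have h3 : (0 : ℝ) < (avoiding A S).card := Nat.cast_pos.2 (Finset.card_pos.2 ih)
    nlinarith

/-- An event determined by the coordinates `u` and `v` is independent of one that does not
depend on these two coordinates. -/
theorem card_filter_mul_card_sq {V α : Type*} [Fintype V] [DecidableEq V] [Fintype α]
    [DecidableEq α] (P : α → α → Prop) [∀ a b, Decidable (P a b)] {u v : V} (huv : u ≠ v)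
    (B : Finset (V → α))
    (hB : ∀ x a b, Function.update (Function.update x u a) v b ∈ B ↔ x ∈ B) :
    (B.filter fun x => P (x u) (x v)).card * Fintype.card α ^ 2 =
      (Finset.univ.filter fun w : α × α => P w.1 w.2).card * B.card := by
  have hα : Fintype.card α ^ 2 = (Finset.univ : Finset (α × α)).card := by
    simp [sq, Finset.card_univ, Fintype.card_prod]
  rw [hα, ← Finset.card_product, ← Finset.card_product]
  refine Finset.card_nbij'
    (fun y => ((y.1 u, y.1 v), Function.update (Function.update y.1 u y.2.1) v y.2.2))
    (fun z => (Function.update (Function.update z.2 u z.1.1) v z.1.2, (z.2 u, z.2 v)))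
    ?_ ?_ ?_ ?_
  · rintro ⟨x, a, b⟩ hx
    simp_all
  · rintro ⟨⟨a, b⟩, x⟩ hx
    simp_all
  · rintro ⟨x, a, b⟩ _
    simp only [Prod.mk.injEq]
    refine ⟨?_, ?_, ?_⟩
    · funext w
      by_cases h1 : w = v <;> by_cases h2 : w = u <;> simp_all
    · simp [huv]
    · simp
  · rintro ⟨⟨a, b⟩, x⟩ _
    simp only [Prod.mk.injEq]
    refine ⟨⟨?_, ?_⟩, ?_⟩
    · simp [huv]
    · simp
    · funext w
      by_cases h1 : w = v <;> by_cases h2 : w = u <;> simp_all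

/-- The exponential moment of the number of coordinates `c ∈ K` with `x c ∈ Z`. -/
theorem sum_pow_card_filter_le {γ ω : Type*} [Fintype γ] [DecidableEq γ] [Fintype ω]
    [DecidableEq ω] [Nonempty ω] (K : Finset γ) (Z : Finset ω) {t : ℝ} (ht : 0 < t) :
    ∑ x : γ → ω, t ^ (K.filter fun c => x c ∈ Z).card ≤
      Real.exp ((t - 1) * (K.card * Z.card / Fintype.card ω)) *
        (Fintype.card ω : ℝ) ^ Fintype.card γ := by
  set f : γ → ω → ℝ := fun c w => if c ∈ K ∧ w ∈ Z then t else 1 with hf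
  have hq : (0 : ℝ) < Fintype.card ω := Nat.cast_pos.2 Fintype.card_pos
  have h1 : ∀ x : γ → ω, t ^ (K.filter fun c => x c ∈ Z).card = ∏ c, f c (x c) := by
    intro x
    rw [hf, Finset.prod_ite, Finset.prod_const_one, mul_one, Finset.prod_const]
    congr 2
    ext c
    simp
  have h2 : ∀ c, ∑ w, f c w ≤
      (if c ∈ K then Real.exp ((t - 1) * (Z.card / Fintype.card ω)) else 1) *
        Fintype.card ω := by
    intro c
    by_cases hc : c ∈ K
    · have hs : ∑ w, f c w = Fintype.card ω + (t - 1) * Z.card := by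
        have : ∀ w, f c w = 1 + (if w ∈ Z then t - 1 else 0) := by
          intro w
          by_cases hw : w ∈ Z <;> simp [hf, hc, hw]
        simp_rw [this, Finset.sum_add_distrib]
        simp only [Finset.sum_const, Finset.card_univ, nsmul_eq_mul, mul_one,
          Finset.sum_ite_mem, Finset.univ_inter]
        ring
      rw [hs, if_pos hc]
      have := Real.add_one_le_exp ((t - 1) * (Z.card / Fintype.card ω))
      refine le_trans (le_of_eq ?_) (mul_le_mul_of_nonneg_right this hq.le)
      field_simp
      ring
    · simp [hf, hc]
  simp_rw [h1]
  rw [← Fintype.piFinset_univ, ← Finset.prod_univ_sum]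
  refine (Finset.prod_le_prod (fun c _ => Finset.sum_nonneg fun w _ => ?_)
    fun c _ => h2 c).trans (le_of_eq ?_)
  · simp only [hf]
    split_ifs <;> positivity
  · rw [Finset.prod_mul_distrib, Finset.prod_ite_mem, Finset.univ_inter, Finset.prod_const,
      Finset.prod_const, ← Real.exp_nat_mul, Finset.card_univ]
    congr 2
    ring

/-- Lower tail estimate. -/
theorem card_filter_lt_le {γ ω : Type*} [Fintype γ] [DecidableEq γ] [Fintype ω]
    [DecidableEq ω] [Nonempty ω] (K : Finset γ) (Z : Finset ω) (m : ℝ) :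
    ((Finset.univ.filter fun x : γ → ω =>
        ((K.filter fun c => x c ∈ Z).card : ℝ) < m).card : ℝ) ≤
      Real.exp (m * Real.log 2 - K.card * Z.card / Fintype.card ω / 2) *
        (Fintype.card ω : ℝ) ^ Fintype.card γ := by
  have h := sum_pow_card_filter_le (γ := γ) K Z (t := 1 / 2) (by norm_num)
  have h1 : ((Finset.univ.filter fun x : γ → ω =>
        ((K.filter fun c => x c ∈ Z).card : ℝ) < m).card : ℝ) * Real.exp (-(m * Real.log 2)) ≤
      ∑ x : γ → ω, (1 / 2 : ℝ) ^ (K.filter fun c => x c ∈ Z).card := by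
    rw [← nsmul_eq_mul]
    refine (Finset.card_nsmul_le_sum _ _ _ ?_).trans
      (Finset.sum_le_sum_of_subset_of_nonneg (Finset.filter_subset _ _)
        fun x _ _ => by positivity)
    intro x hx
    have hx' := (Finset.mem_filter.1 hx).2
    have h2 : (1 / 2 : ℝ) = Real.exp (-Real.log 2) := by
      rw [Real.exp_neg, Real.exp_log (by norm_num)]; norm_num
    rw [h2, ← Real.exp_nat_mul, Real.exp_le_exp]
    nlinarith [Real.log_pos (by norm_num : (1 : ℝ) < 2)]
  have h3 := mul_le_mul_of_nonneg_right (h1.trans h) (Real.exp_pos (m * Real.log 2)).le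
  rw [mul_assoc, ← Real.exp_add, neg_add_cancel, Real.exp_zero, mul_one] at h3
  refine h3.trans (le_of_eq ?_)
  rw [mul_right_comm, ← Real.exp_add]
  congr 2
  ring

/-- Upper tail estimate. -/
theorem card_filter_gt_le {γ ω : Type*} [Fintype γ] [DecidableEq γ] [Fintype ω]
    [DecidableEq ω] [Nonempty ω] (K : Finset γ) (Z : Finset ω) (m : ℝ) :
    ((Finset.univ.filter fun x : γ → ω =>
        m < ((K.filter fun c => x c ∈ Z).card : ℝ)).card : ℝ) ≤
      Real.exp (K.card * Z.card / Fintype.card ω - m * Real.log 2) *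
        (Fintype.card ω : ℝ) ^ Fintype.card γ := by
  have h := sum_pow_card_filter_le (γ := γ) K Z (t := 2) (by norm_num)
  have h1 : ((Finset.univ.filter fun x : γ → ω =>
        m < ((K.filter fun c => x c ∈ Z).card : ℝ)).card : ℝ) * Real.exp (m * Real.log 2) ≤
      ∑ x : γ → ω, (2 : ℝ) ^ (K.filter fun c => x c ∈ Z).card := by
    rw [← nsmul_eq_mul]
    refine (Finset.card_nsmul_le_sum _ _ _ ?_).trans
      (Finset.sum_le_sum_of_subset_of_nonneg (Finset.filter_subset _ _)
        fun x _ _ => by positivity)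
    intro x hx
    have hx' := (Finset.mem_filter.1 hx).2
    have h2 : (2 : ℝ) = Real.exp (Real.log 2) := (Real.exp_log (by norm_num)).symm
    conv_rhs => rw [h2]
    rw [← Real.exp_nat_mul, Real.exp_le_exp]
    nlinarith [Real.log_pos (by norm_num : (1 : ℝ) < 2)]
  have h3 := mul_le_mul_of_nonneg_right (h1.trans h) (Real.exp_pos (-(m * Real.log 2))).le
  rw [mul_assoc, ← Real.exp_add, add_neg_cancel, Real.exp_zero, mul_one] at h3
  refine h3.trans (le_of_eq ?_)
  rw [mul_right_comm, ← Real.exp_add]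
  congr 2
  ring

/-- For a uniformly random pair of sets of colours of density `1 / q`, it is unlikely that few
colours of `K` lie in both sets or that many lie in at least one of them. -/
theorem card_filter_pair_le {γ : Type*} [Fintype γ] [DecidableEq γ] (q : ℕ) [NeZero q]
    (K : Finset γ) (m s : ℝ) :
    ((Finset.univ.filter fun w : (γ → Fin q) × (γ → Fin q) =>
        ((K.filter fun c => w.1 c = 0 ∧ w.2 c = 0).card : ℝ) < m ∨
          s < ((K.filter fun c => w.1 c = 0 ∨ w.2 c = 0).card : ℝ)).card : ℝ) ≤
      (Real.exp (m * Real.log 2 - K.card / (q : ℝ) ^ 2 / 2) +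
        Real.exp (2 * K.card / q - s * Real.log 2)) * (Fintype.card (γ → Fin q) : ℝ) ^ 2 := by
  have hq : (0 : ℝ) < q := Nat.cast_pos.2 (NeZero.pos q)
  set Z₁ : Finset (Fin q × Fin q) := {(0, 0)} with hZ₁
  set Z₂ : Finset (Fin q × Fin q) := Finset.univ.filter fun w => w.1 = 0 ∨ w.2 = 0 with hZ₂
  have hc₁ : Z₁.card = 1 := by simp [hZ₁]
  have hc₂ : (Z₂.card : ℝ) ≤ 2 * q := by
    have hsub : Z₂ ⊆ ({0} ×ˢ Finset.univ) ∪ (Finset.univ ×ˢ {0}) := by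
      intro w hw
      simpa only [hZ₂, Finset.mem_union, Finset.mem_product, Finset.mem_singleton,
        Finset.mem_filter, Finset.mem_univ, true_and, and_true] using hw
    have := (Finset.card_le_card hsub).trans (Finset.card_union_le _ _)
    simp only [Finset.card_product, Finset.card_singleton, Finset.card_univ,
      Fintype.card_fin] at this
    have h' : Z₂.card ≤ 2 * q := by omega
    exact_mod_cast h'
  have hcard : (Fintype.card (Fin q × Fin q) : ℝ) = (q : ℝ) ^ 2 := by
    simp [sq]
  have hpow : (Fintype.card (γ → Fin q) : ℝ) ^ 2 =
      (Fintype.card (Fin q × Fin q) : ℝ) ^ Fintype.card γ := by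
    rw [hcard]
    simp [← pow_mul, mul_comm]
  have h₁ := card_filter_lt_le (γ := γ) K Z₁ m
  have h₂ := card_filter_gt_le (γ := γ) K Z₂ s
  have hle : (Finset.univ.filter fun w : (γ → Fin q) × (γ → Fin q) =>
        ((K.filter fun c => w.1 c = 0 ∧ w.2 c = 0).card : ℝ) < m ∨
          s < ((K.filter fun c => w.1 c = 0 ∨ w.2 c = 0).card : ℝ)).card ≤
      ((Finset.univ.filter fun x : γ → Fin q × Fin q =>
        ((K.filter fun c => x c ∈ Z₁).card : ℝ) < m) ∪
      (Finset.univ.filter fun x : γ → Fin q × Fin q =>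
        s < ((K.filter fun c => x c ∈ Z₂).card : ℝ))).card := by
    refine Finset.card_le_card_of_injOn (fun w c => (w.1 c, w.2 c)) ?_ ?_
    · intro w hw
      simpa [hZ₁, hZ₂, Prod.ext_iff] using hw
    · rintro ⟨a, b⟩ _ ⟨a', b'⟩ _ hab
      have := fun c => congrFun hab c
      simp only [Prod.mk.injEq] at this
      exact Prod.ext (funext fun c => (this c).1) (funext fun c => (this c).2)
  have hle' := Nat.cast_le (α := ℝ).2 (hle.trans (Finset.card_union_le _ _))
  push_cast at hle'
  rw [hpow, add_mul]
  refine hle'.trans (add_le_add (h₁.trans (le_of_eq ?_)) (h₂.trans ?_))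
  · rw [hc₁, hcard, Nat.cast_one, mul_one]
  · refine mul_le_mul_of_nonneg_right (Real.exp_le_exp.2 (sub_le_sub_right ?_ _))
      (by positivity)
    rw [hcard, div_le_div_iff₀ (by positivity) hq]
    have := mul_le_mul_of_nonneg_left hc₂ (by positivity : (0 : ℝ) ≤ K.card * q)
    nlinarith

/-- The ordered pairs of adjacent vertices that meet `{u, v}`. -/
def meetingPairs {V : Type*} [Fintype V] [DecidableEq V] (G : SimpleGraph V)
    [DecidableRel G.Adj] (e : V × V) : Finset (V × V) :=
  Finset.univ.filter fun f =>
    G.Adj f.1 f.2 ∧ (f.1 = e.1 ∨ f.1 = e.2 ∨ f.2 = e.1 ∨ f.2 = e.2)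

theorem card_meetingPairs_le {V : Type*} [Fintype V] [DecidableEq V] (G : SimpleGraph V)
    [DecidableRel G.Adj] (e : V × V) : (meetingPairs G e).card ≤ 4 * G.maxDegree := by
  have hsub : meetingPairs G e ⊆
      (({e.1} ×ˢ G.neighborFinset e.1) ∪ ({e.2} ×ˢ G.neighborFinset e.2)) ∪
      ((G.neighborFinset e.1 ×ˢ {e.1}) ∪ (G.neighborFinset e.2 ×ˢ {e.2})) := by
    rintro ⟨a, b⟩ hf
    simp only [meetingPairs, Finset.mem_filter, Finset.mem_univ, true_and] at hf
    obtain ⟨hab, rfl | rfl | rfl | rfl⟩ := hf <;> simp [hab, hab.symm]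
  refine (Finset.card_le_card hsub).trans ((Finset.card_union_le _ _).trans
    ((Nat.add_le_add (Finset.card_union_le _ _) (Finset.card_union_le _ _)).trans ?_))
  simp only [Finset.card_product, Finset.card_singleton, SimpleGraph.card_neighborFinset_eq_degree]
  have h1 := G.degree_le_maxDegree e.1
  have h2 := G.degree_le_maxDegree e.2
  omega

/-- Reserving colours when the palette is finite. -/
theorem exists_reserved_of_fintype {V γ : Type*} [Fintype V] [DecidableEq V] [Fintype γ]
    [DecidableEq γ] (G : SimpleGraph V) [DecidableRel G.Adj] (K : V → V → Finset γ)
    (q : ℕ) [NeZero q] {m s p : ℝ} (hp : 0 ≤ p) (hp' : 2 * p < 1)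
    (hpd : 16 * p * G.maxDegree ≤ 1)
    (h : ∀ u v, G.Adj u v →
      Real.exp (m * Real.log 2 - (K u v).card / (q : ℝ) ^ 2 / 2) +
        Real.exp (2 * (K u v).card / q - s * Real.log 2) ≤ p) :
    ∃ Q : V → Finset γ, ∀ u v, G.Adj u v →
      m ≤ ((K u v ∩ Q u ∩ Q v).card : ℝ) ∧ ((K u v ∩ (Q u ∪ Q v)).card : ℝ) ≤ s := by
  let P : V → V → (γ → Fin q) → (γ → Fin q) → Prop := fun u v a b =>
    (((K u v).filter fun c => a c = 0 ∧ b c = 0).card : ℝ) < m ∨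
      s < (((K u v).filter fun c => a c = 0 ∨ b c = 0).card : ℝ)
  classical
  let A : V × V → Finset (V → γ → Fin q) := fun e =>
    Finset.univ.filter fun x => G.Adj e.1 e.2 ∧ P e.1 e.2 (x e.1) (x e.2)
  have hA : ∀ e x, x ∈ A e ↔ G.Adj e.1 e.2 ∧ P e.1 e.2 (x e.1) (x e.2) := fun e x => by
    simp only [A, Finset.mem_filter, Finset.mem_univ, true_and]
  have hdep : ∀ e T, Disjoint (meetingPairs G e) T →
      ((A e ∩ avoiding A T).card : ℝ) ≤ p * (avoiding A T).card := by
    rintro ⟨u, v⟩ T hT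
    by_cases huv : G.Adj u v
    · have hB : ∀ x a b, Function.update (Function.update x u a) v b ∈ avoiding A T ↔
          x ∈ avoiding A T := by
        intro x a b
        rw [mem_avoiding, mem_avoiding]
        refine forall₂_congr fun f hf => ?_
        by_cases hadj : G.Adj f.1 f.2
        · have hmeet := fun h' => Finset.disjoint_left.1 hT h' hf
          simp only [meetingPairs, Finset.mem_filter, Finset.mem_univ, true_and, hadj,
            imp_false, not_or] at hmeet
          obtain ⟨h1, h2, h3, h4⟩ := hmeet
          rw [hA, hA, Function.update_of_ne h2, Function.update_of_ne h1,
            Function.update_of_ne h4, Function.update_of_ne h3]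
        · simp only [hA, hadj, false_and]
      have hcount := card_filter_mul_card_sq (P u v) huv.ne (avoiding A T) hB
      have hpair := (card_filter_pair_le q (K u v) m s).trans
        (mul_le_mul_of_nonneg_right (h u v huv) (by positivity))
      have hset : A (u, v) ∩ avoiding A T =
          (avoiding A T).filter fun x => P u v (x u) (x v) := by
        ext x
        rw [Finset.mem_inter, hA, and_iff_right huv, and_comm, Finset.mem_filter]
      rw [hset]
      have hpos : (0 : ℝ) < (Fintype.card (γ → Fin q) : ℝ) ^ 2 := by
        have : 0 < Fintype.card (γ → Fin q) := Fintype.card_pos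
        positivity
      refine le_of_mul_le_mul_right ?_ hpos
      have hcount' := congrArg (Nat.cast (R := ℝ)) hcount
      push_cast at hcount'
      rw [hcount', mul_right_comm]
      refine mul_le_mul_of_nonneg_right ?_ (by positivity)
      convert hpair
    · have : A (u, v) = ∅ :=
        Finset.eq_empty_of_forall_notMem fun x hx => huv ((hA _ x).1 hx).1
      rw [this, Finset.empty_inter, Finset.card_empty, Nat.cast_zero]
      positivity
  obtain ⟨x, hx⟩ := avoiding_nonempty A (meetingPairs G) (d := 4 * G.maxDegree) hp hp'
    (fun e => by exact_mod_cast card_meetingPairs_le G e) (by linarith) hdep Finset.univ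
  refine ⟨fun v => Finset.univ.filter fun c => x v c = 0, fun u v huv => ?_⟩
  have hgood := mem_avoiding.1 hx (u, v) (Finset.mem_univ _)
  rw [hA, and_iff_right huv] at hgood
  simp only [P, not_or, not_lt] at hgood
  refine ⟨hgood.1.trans_eq ?_, le_of_eq_of_le ?_ hgood.2⟩
  · congr 2
    ext c
    simp
  · congr 2
    ext c
    simp

/-- The growth estimates needed for the choice of the reservation density. -/
theorem exists_log_threshold : ∃ D₀ : ℕ, ∀ D : ℕ, D₀ ≤ D →
    20 ≤ Real.log D ∧ 25 * Real.log D ^ 4 ≤ Real.sqrt D := by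
  have h1 : ∀ᶠ x : ℝ in Filter.atTop, 20 ≤ Real.log x :=
    Real.tendsto_log_atTop.eventually_ge_atTop 20
  have h2 : ∀ᶠ x : ℝ in Filter.atTop, ‖Real.log x ^ 8‖ ≤ (1 / 625) * ‖x‖ :=
    (Real.isLittleO_pow_log_id_atTop (n := 8)).bound (by norm_num)
  have h3 := tendsto_natCast_atTop_atTop (R := ℝ) |>.eventually (h1.and h2)
  obtain ⟨D₀, hD₀⟩ := Filter.eventually_atTop.1 h3
  refine ⟨D₀, fun D hD => ?_⟩
  obtain ⟨ha, hb⟩ := hD₀ D hD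
  refine ⟨ha, Real.le_sqrt_of_sq_le ?_⟩
  rw [Real.norm_of_nonneg (by positivity), Real.norm_of_nonneg (by positivity)] at hb
  nlinarith

/-- The tail bounds are small enough for the local lemma. -/
theorem exp_add_exp_le {D l r N q : ℝ} (hr : 0 < r) (hD : D = r ^ 2) (hl : Real.exp l = D)
    (hl20 : 20 ≤ l) (hlr : 25 * l ^ 4 ≤ r) (hq : 0 < q) (hq1 : q ≤ r / l ^ 4)
    (hq2 : r / l ^ 4 < q + 1) (hN1 : D ≤ N) (hN2 : N ≤ D + 5 * r * l ^ 4) :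
    Real.exp (1 / 2 * l ^ 8 * Real.log 2 - N / q ^ 2 / 2) +
      Real.exp (2 * N / q - (4 * r * l ^ 4 - 1) * Real.log 2) ≤ 1 / (16 * D) := by
  have hl4 : 0 < l ^ 4 := by positivity
  have hlog1 := Real.log_two_gt_d9
  have hlog2 := Real.log_two_lt_d9
  have hql : q * l ^ 4 ≤ r := (le_div_iff₀ hl4).1 hq1
  have hql' : r < (q + 1) * l ^ 4 := (div_lt_iff₀ hl4).1 hq2
  have h8 : l ^ 8 = l ^ 4 * l ^ 4 := by ring
  have hl7 : (20 : ℝ) ^ 3 * l ≤ l ^ 4 := by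
    have : (20 : ℝ) ^ 3 ≤ l ^ 3 := by gcongr
    nlinarith
  have hl1 : 1 ≤ l ^ 4 := by nlinarith
  have hl8 : l ^ 4 ≤ l ^ 8 := by nlinarith
  have key : ∀ y, y ≤ -l - 4 → Real.exp y ≤ 1 / (32 * D) := by
    intro y hy
    have h32 : (32 : ℝ) ≤ Real.exp 4 := by
      have h := Real.exp_one_gt_d9
      have h4 : Real.exp 4 = Real.exp 1 ^ 4 := by rw [← Real.exp_nat_mul]; norm_num
      have : (2.5 : ℝ) ^ 4 ≤ Real.exp 1 ^ 4 := by gcongr; linarith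
      rw [h4]
      norm_num at this ⊢
      linarith
    have hDp : 0 < D := by rw [← hl]; exact Real.exp_pos l
    refine (Real.exp_le_exp.2 hy).trans ?_
    rw [show -l - 4 = -(l + 4) by ring, Real.exp_neg, Real.exp_add, hl, ← one_div]
    refine one_div_le_one_div_of_le (by positivity) ?_
    nlinarith
  have e1 : l ^ 8 ≤ N / q ^ 2 := by
    rw [le_div_iff₀ (by positivity)]
    have : (q * l ^ 4) ^ 2 ≤ r ^ 2 := by gcongr
    nlinarith
  have e2 : 2 * N / q ≤ 5 / 2 * (r * l ^ 4) := by
    rw [div_le_iff₀ hq]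
    have h1 := mul_lt_mul_of_pos_left hql' hr
    have h2 := mul_le_mul_of_nonneg_left hlr hr.le
    nlinarith
  have e3 : l ^ 8 ≤ r * l ^ 4 := by nlinarith
  have f1 := key (1 / 2 * l ^ 8 * Real.log 2 - N / q ^ 2 / 2) (by nlinarith)
  have f2 := key (2 * N / q - (4 * r * l ^ 4 - 1) * Real.log 2) (by nlinarith)
  have : 1 / (32 * D) + 1 / (32 * D) = 1 / (16 * D) := by
    have hDp : 0 < D := by rw [← hl]; exact Real.exp_pos l
    field_simp
    norm_num
  linarith


/-- (Claim 1 of the paper.) There are constants `C₀ > 0` with `C' = C₀ - 4 > 0` and `Δ₀`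
such that for every finite simple graph `G` with maximum degree `Δ ≥ Δ₀` and minimum
degree `δ ≥ Δ/4`, and lists of size exactly `Δ + ⌊C₀·Δ^(1/2)·(log Δ)^4⌋` on the edges,
one can choose sets `R_v ⊆ ⋃_{e ∈ E(v)} L_e` of reserved colours so that every edge `uv`
satisfies `|L_{uv} ∩ R_u ∩ R_v| ≥ (1/2)(log Δ)^8` and
`|L_{uv} \ (R_u ∪ R_v)| ≥ Δ + C'·Δ^(1/2)·(log Δ)^4`. -/
theorem reserving_colours :
    ∃ (C₀ : ℝ) (Δ₀ : ℕ), 0 < C₀ ∧ 0 < C₀ - 4 ∧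
      ∀ (V β : Type) [Fintype V] [DecidableEq V] [DecidableEq β]
        (G : SimpleGraph V) [DecidableRel G.Adj] (L : Sym2 V → Finset β),
        -- maximum degree at least Δ₀
        Δ₀ ≤ G.maxDegree →
        -- minimum degree at least Δ/4
        (∀ v : V, (G.maxDegree : ℝ) / 4 ≤ (G.degree v : ℝ)) →
        -- lists have the prescribed size
        (∀ e ∈ G.edgeFinset,
          (L e).card =
            G.maxDegree + ⌊C₀ * Real.sqrt (G.maxDegree) * (Real.log (G.maxDegree)) ^ 4⌋₊) →
        ∃ R : V → Finset β,
          (∀ v : V, R v ⊆ (G.incidenceFinset v).biUnion L) ∧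
          (∀ u v : V, G.Adj u v →
            -- (i) many reserved colours on each edge
            (1 / 2 : ℝ) * (Real.log (G.maxDegree)) ^ 8 ≤
              (((L s(u, v) ∩ R u ∩ R v).card : ℝ)) ∧
            -- (ii) the leftover lists are still long
            (G.maxDegree : ℝ) +
                (C₀ - 4) * Real.sqrt (G.maxDegree) * (Real.log (G.maxDegree)) ^ 4 ≤
              (((L s(u, v) \ (R u ∪ R v)).card : ℝ))) := by
  obtain ⟨D₀, hD₀⟩ := exists_log_threshold
  refine ⟨5, D₀, by norm_num, by norm_num, ?_⟩
  intro V β _ _ _ G _ L hΔ _ hL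
  obtain ⟨hl20, hlr⟩ := hD₀ _ hΔ
  set D : ℝ := (G.maxDegree : ℝ) with hD
  set l := Real.log D with hl
  set r := Real.sqrt D with hr
  have hDpos : 0 < D := by
    by_contra hcon
    have : D = 0 := le_antisymm (not_lt.1 hcon) (Nat.cast_nonneg _)
    rw [hl, this, Real.log_zero] at hl20
    norm_num at hl20
  have hexp : Real.exp l = D := Real.exp_log hDpos
  have hr0 : 0 < r := Real.sqrt_pos.2 hDpos
  have hl4 : 0 < l ^ 4 := by positivity
  have hrl : 25 ≤ r / l ^ 4 := (le_div_iff₀ hl4).2 hlr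
  set q := ⌊r / l ^ 4⌋₊ with hq
  have hq1 : (q : ℝ) ≤ r / l ^ 4 := Nat.floor_le (by positivity)
  have hq2 : r / l ^ 4 < q + 1 := Nat.lt_floor_add_one _
  have hq0 : (0 : ℝ) < q := by linarith
  have : NeZero q := ⟨(Nat.cast_pos.1 hq0).ne'⟩
  set U : Finset β := G.edgeFinset.biUnion L with hU
  have hLU : ∀ u v, G.Adj u v → L s(u, v) ⊆ U := fun u v huv =>
    Finset.subset_biUnion_of_mem L (by simpa using huv)
  let K : V → V → Finset U := fun u v => (L s(u, v)).subtype (· ∈ U)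
  have hKmap : ∀ u v, G.Adj u v →
      (K u v).map (Function.Embedding.subtype _) = L s(u, v) := fun u v huv =>
    Finset.subtype_map_of_mem fun c hc => hLU u v huv hc
  have hcard : ∀ u v, G.Adj u v → (L s(u, v)).card = G.maxDegree + ⌊5 * r * l ^ 4⌋₊ :=
    fun u v huv => hL _ (by simpa using huv)
  have hKcard : ∀ u v, G.Adj u v → (K u v).card = (L s(u, v)).card := fun u v huv => by
    rw [← hKmap u v huv, Finset.card_map]
  have hfl1 : (⌊5 * r * l ^ 4⌋₊ : ℝ) ≤ 5 * r * l ^ 4 := Nat.floor_le (by positivity)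
  have hfl2 : 5 * r * l ^ 4 < ⌊5 * r * l ^ 4⌋₊ + 1 := Nat.lt_floor_add_one _
  have hD1 : 1 ≤ D := Nat.one_le_cast.2 (Nat.cast_pos.1 hDpos)
  obtain ⟨Q, hQ⟩ := exists_reserved_of_fintype G K q (m := 1 / 2 * l ^ 8)
    (s := 4 * r * l ^ 4 - 1) (p := 1 / (16 * D)) (by positivity)
    (by
      rw [mul_one_div, div_lt_one (by positivity)]
      linarith)
    (by
      rw [← hD]
      field_simp
      norm_num)
    (fun u v huv => by
      rw [hKcard u v huv, hcard u v huv]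
      push_cast
      exact exp_add_exp_le hr0 (Real.sq_sqrt hDpos.le).symm hexp hl20 hlr hq0 hq1 hq2
        (by rw [← hD]; linarith [(Nat.cast_nonneg _ : (0 : ℝ) ≤ (⌊5 * r * l ^ 4⌋₊ : ℝ))])
        (by rw [← hD]; linarith))
  let R : V → Finset β := fun v =>
    (Q v).map (Function.Embedding.subtype _) ∩ (G.incidenceFinset v).biUnion L
  have hLinc : ∀ u v, G.Adj u v → L s(u, v) ⊆ (G.incidenceFinset u).biUnion L :=
    fun u v huv => Finset.subset_biUnion_of_mem L (by simpa using huv)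
  refine ⟨R, fun v => Finset.inter_subset_right, fun u v huv => ?_⟩
  obtain ⟨h1, h2⟩ := hQ u v huv
  have hu : ∀ c ∈ L s(u, v), c ∈ (G.incidenceFinset u).biUnion L := hLinc u v huv
  have hv : ∀ c ∈ L s(u, v), c ∈ (G.incidenceFinset v).biUnion L := by
    rw [Sym2.eq_swap]
    exact hLinc v u huv.symm
  have hR : ∀ w c, c ∈ R w ↔
      c ∈ (Q w).map (Function.Embedding.subtype _) ∧ c ∈ (G.incidenceFinset w).biUnion L :=
    fun w c => Finset.mem_inter
  have hinter : L s(u, v) ∩ R u ∩ R v =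
      (K u v ∩ Q u ∩ Q v).map (Function.Embedding.subtype _) := by
    rw [Finset.map_inter, Finset.map_inter, hKmap u v huv]
    ext c
    have := hu c
    have := hv c
    simp only [Finset.mem_inter, hR]
    tauto
  have hunion : L s(u, v) ∩ (R u ∪ R v) =
      (K u v ∩ (Q u ∪ Q v)).map (Function.Embedding.subtype _) := by
    rw [Finset.map_inter, Finset.map_union, hKmap u v huv]
    ext c
    have := hu c
    have := hv c
    simp only [Finset.mem_inter, Finset.mem_union, hR]
    tauto
  refine ⟨?_, ?_⟩
  · rw [hinter, Finset.card_map]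
    exact h1
  · have hsum := Finset.card_sdiff_add_card_inter (L s(u, v)) (R u ∪ R v)
    rw [hunion, Finset.card_map, hcard u v huv] at hsum
    have hsum' := congrArg (Nat.cast (R := ℝ)) hsum
    push_cast at hsum'
    rw [← hD] at hsum'
    linarith
end

section
/- There exists a constant Δ₀ such that the following holds. Let G = (V,E) be a finite simple graph with maximum degree Δ ≥ Δ₀ and minimum degree δ ≥ Δ/4, and let c be a proper edge colouring of G. Then there exists a set U ⊆ E of edges such that, writing U_v = U ∩ E(v) and S_v = {c(e) : e ∈ E(v) ∖ U}: (iii) (1/8)·(log Δ)² ≤ |U_v| ≤ (3/2)·(log Δ)² for every vertex v ∈ V, and (iv) |S_u △ S_v| ≥ (1/16)·(log Δ)² for every edge uv ∈ E with d(u) = d(v). -/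
/-- The expectation of `f U` for a random subset `U` of `s` that contains each element of `s`
independently with probability `p`. -/
noncomputable def randomSubsetExp {ι : Type*} (s : Finset ι) (p : ℝ) (f : Finset ι → ℝ) : ℝ :=
  ∑ U ∈ s.powerset, p ^ U.card * (1 - p) ^ (s.card - U.card) * f U

section RandomSubset

variable {ι κ : Type*} {s : Finset ι} {p : ℝ}

lemma randomSubsetExp_const (a : ℝ) : randomSubsetExp s p (fun _ => a) = a := by
  simp [randomSubsetExp, ← Finset.sum_mul, Finset.sum_pow_mul_eq_add_pow]

lemma randomSubsetExp_const_mul (a : ℝ) (f : Finset ι → ℝ) :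
    randomSubsetExp s p (fun U => a * f U) = a * randomSubsetExp s p f := by
  simp only [randomSubsetExp, Finset.mul_sum]
  exact Finset.sum_congr rfl fun U _ => by ring

lemma randomSubsetExp_add (f g : Finset ι → ℝ) :
    randomSubsetExp s p (fun U => f U + g U) =
      randomSubsetExp s p f + randomSubsetExp s p g := by
  simp only [randomSubsetExp, mul_add, Finset.sum_add_distrib]

lemma randomSubsetExp_sub (f g : Finset ι → ℝ) :
    randomSubsetExp s p (fun U => f U - g U) =
      randomSubsetExp s p f - randomSubsetExp s p g := by
  simp only [randomSubsetExp, mul_sub, Finset.sum_sub_distrib]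

lemma randomSubsetExp_sum (K : Finset κ) (f : κ → Finset ι → ℝ) :
    randomSubsetExp s p (fun U => ∑ k ∈ K, f k U) = ∑ k ∈ K, randomSubsetExp s p (f k) := by
  simp only [randomSubsetExp, Finset.mul_sum]
  exact Finset.sum_comm

lemma randomSubsetExp_mono (hp₀ : 0 ≤ p) (hp₁ : p ≤ 1) {f g : Finset ι → ℝ}
    (h : ∀ U ⊆ s, f U ≤ g U) : randomSubsetExp s p f ≤ randomSubsetExp s p g := by
  have := sub_nonneg.2 hp₁
  exact Finset.sum_le_sum fun U hU =>
    mul_le_mul_of_nonneg_left (h U (Finset.mem_powerset.1 hU)) (by positivity)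

variable [DecidableEq ι]

lemma randomSubsetExp_mem {e : ι} (he : e ∈ s) :
    randomSubsetExp s p (fun U => if e ∈ U then 1 else 0) = p := by
  obtain ⟨t, het, rfl⟩ : ∃ t, e ∉ t ∧ insert e t = s :=
    ⟨s.erase e, Finset.notMem_erase e s, Finset.insert_erase he⟩
  rw [randomSubsetExp, Finset.sum_powerset_insert het, Finset.sum_eq_zero, zero_add]
  · calc _ = ∑ U ∈ t.powerset, p * (p ^ U.card * (1 - p) ^ (t.card - U.card) * 1) := by
          refine Finset.sum_congr rfl fun U hU => ?_
          have heU : e ∉ U := fun h => het (Finset.mem_powerset.1 hU h)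
          simp only [Finset.card_insert_of_notMem heU, Finset.card_insert_of_notMem het,
            Finset.mem_insert_self, if_true, Nat.add_sub_add_right]
          ring
      _ = p := by
          rw [← Finset.mul_sum]
          exact (congrArg _ (randomSubsetExp_const (s := t) (p := p) 1)).trans (mul_one p)
  · intro U hU
    simp [show e ∉ U from fun h => het (Finset.mem_powerset.1 hU h)]

/-- A function of `U ∩ T` and a function of `U \ T` are independent. -/
lemma randomSubsetExp_mul (T : Finset ι) {f g : Finset ι → ℝ}
    (hf : ∀ U, f (U ∩ T) = f U) (hg : ∀ U, g (U \ T) = g U) :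
    randomSubsetExp s p (fun U => f U * g U) =
      randomSubsetExp s p f * randomSubsetExp s p g := by
  rw [← mul_one (randomSubsetExp s p fun U => f U * g U),
    ← randomSubsetExp_const (s := s) (p := p) 1]
  simp only [randomSubsetExp, Finset.sum_mul_sum, ← Finset.sum_product']
  let mix : Finset ι → Finset ι → Finset ι := fun U W => (U ∩ T) ∪ (W \ T)
  have mix_inter (U W) : mix U W ∩ T = U ∩ T := by grind
  have mix_sdiff (U W) : mix U W \ T = W \ T := by grind
  have mix_mix (U W W' U') : mix (mix U W) (mix W' U') = mix U U' := by grind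
  have mix_self (U) : mix U U = U := by grind
  have mix_subset {U W} (hU : U ⊆ s) (hW : W ⊆ s) : mix U W ⊆ s := by grind
  have card_mix (U W) : (mix U W).card = (U ∩ T).card + (W \ T).card :=
    Finset.card_union_of_disjoint (by
      rw [Finset.disjoint_left]
      grind)
  have card_split (U : Finset ι) : U.card = (U ∩ T).card + (U \ T).card :=
    (Finset.card_inter_add_card_sdiff U T).symm
  refine Finset.sum_nbij' (fun x => (mix x.1 x.2, mix x.2 x.1))
    (fun x => (mix x.1 x.2, mix x.2 x.1)) ?_ ?_ ?_ ?_ ?_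
  · intro x hx
    simp only [Finset.mem_product, Finset.mem_powerset] at hx ⊢
    exact ⟨mix_subset hx.1 hx.2, mix_subset hx.2 hx.1⟩
  · intro x hx
    simp only [Finset.mem_product, Finset.mem_powerset] at hx ⊢
    exact ⟨mix_subset hx.1 hx.2, mix_subset hx.2 hx.1⟩
  · intro x _
    simp [mix_mix, mix_self]
  · intro x _
    simp [mix_mix, mix_self]
  · rintro ⟨U, W⟩ hx
    simp only [Finset.mem_product, Finset.mem_powerset] at hx
    have h1 := Finset.card_le_card hx.1
    have h2 := Finset.card_le_card hx.2
    have h3 := Finset.card_le_card (mix_subset hx.1 hx.2)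
    have h4 := Finset.card_le_card (mix_subset hx.2 hx.1)
    have h5 : (mix U W).card + (mix W U).card = U.card + W.card := by
      rw [card_mix, card_mix, card_split U, card_split W]
      ring
    have hfm : f (mix U W) = f U := by rw [← hf, mix_inter, hf]
    have hgm : g (mix W U) = g U := by rw [← hg, mix_sdiff, hg]
    simp only [hfm, hgm]
    have hw : ∀ a b : ℕ, p ^ a * (1 - p) ^ (s.card - a) * (p ^ b * (1 - p) ^ (s.card - b)) =
        p ^ (a + b) * (1 - p) ^ ((s.card - a) + (s.card - b)) := fun a b => by ring
    have h6 : (s.card - (mix U W).card) + (s.card - (mix W U).card) =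
      (s.card - U.card) + (s.card - W.card) := by omega
    have h7 := hw (mix U W).card (mix W U).card
    rw [h5, h6, ← hw] at h7
    linear_combination -(f U * g U) * h7

lemma apply_sdiff_of_disjoint {T T' : Finset ι} {f : Finset ι → ℝ}
    (hf : ∀ U, f (U ∩ T') = f U) (h : Disjoint T T') (U : Finset ι) : f (U \ T) = f U := by
  rw [← hf (U \ T), ← hf U]
  congr 1
  rw [Finset.disjoint_left] at h
  grind

lemma randomSubsetExp_prod {K : Finset κ} {f : κ → Finset ι → ℝ} {T : κ → Finset ι}
    (hf : ∀ k ∈ K, ∀ U, f k (U ∩ T k) = f k U)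
    (hT : (K : Set κ).PairwiseDisjoint T) :
    randomSubsetExp s p (fun U => ∏ k ∈ K, f k U) = ∏ k ∈ K, randomSubsetExp s p (f k) := by
  classical
  induction K using Finset.induction_on with
  | empty => simpa using randomSubsetExp_const 1
  | insert a K ha ih =>
    simp only [Finset.prod_insert ha]
    rw [randomSubsetExp_mul (T a) (hf a (Finset.mem_insert_self a K)), ih]
    · exact fun k hk => hf k (Finset.mem_insert_of_mem hk)
    · exact hT.subset (by simp)
    · intro U
      refine Finset.prod_congr rfl fun k hk => ?_
      refine apply_sdiff_of_disjoint (hf k (Finset.mem_insert_of_mem hk)) ?_ U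
      exact hT (by simp) (by simp [hk]) (by rintro rfl; exact ha hk)

/-- The Chernoff bound. The sign of `t` selects the tail. -/
lemma randomSubsetExp_chernoff (hp₀ : 0 ≤ p) (hp₁ : p ≤ 1) {K : Finset κ}
    {X : κ → Finset ι → Prop} [∀ k, DecidablePred (X k)] {T : κ → Finset ι} {r : ℝ}
    (hX : ∀ k ∈ K, ∀ U, X k (U ∩ T k) ↔ X k U) (hT : (K : Set κ).PairwiseDisjoint T)
    (hr : ∀ k ∈ K, randomSubsetExp s p (fun U => if X k U then 1 else 0) = r)
    (hr₀ : 0 ≤ r) (hr₁ : r ≤ 1) (t a : ℝ) :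
    randomSubsetExp s p
        (fun U => if t * a ≤ t * ((K.filter fun k => X k U).card : ℝ) then 1 else 0) ≤
      Real.exp (r * K.card * (Real.exp t - 1) - t * a) := by
  calc _ ≤ randomSubsetExp s p (fun U => Real.exp (-(t * a)) *
          ∏ k ∈ K, (1 + (Real.exp t - 1) * (if X k U then 1 else 0))) := by
        refine randomSubsetExp_mono hp₀ hp₁ fun U _ => ?_
        have hprod : ∏ k ∈ K, (1 + (Real.exp t - 1) * (if X k U then (1 : ℝ) else 0)) =
            Real.exp (t * ((K.filter fun k => X k U).card : ℝ)) := by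
          rw [mul_comm t, Real.exp_nat_mul, ← Finset.prod_const, Finset.prod_filter]
          refine Finset.prod_congr rfl fun k _ => ?_
          split_ifs <;> ring
        rw [hprod, ← Real.exp_add]
        split_ifs with h
        · exact Real.one_le_exp (by linarith)
        · positivity
    _ = Real.exp (-(t * a)) * (1 + (Real.exp t - 1) * r) ^ K.card := by
        rw [randomSubsetExp_const_mul, randomSubsetExp_prod (T := T) _ hT]
        · rw [Finset.prod_congr rfl (g := fun _ => 1 + (Real.exp t - 1) * r), Finset.prod_const]
          intro k hk
          rw [randomSubsetExp_add, randomSubsetExp_const, randomSubsetExp_const_mul, hr k hk]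
        · intro k hk U
          simp only [hX k hk U]
    _ ≤ Real.exp (-(t * a)) * Real.exp ((Real.exp t - 1) * r) ^ K.card := by
        have hnonneg : 0 ≤ 1 + (Real.exp t - 1) * r := by nlinarith [Real.exp_pos t]
        gcongr
        linarith [Real.add_one_le_exp ((Real.exp t - 1) * r)]
    _ = _ := by
        rw [← Real.exp_nat_mul, ← Real.exp_add]
        congr 1
        ring

lemma one_sub_sum_le_prod_one_sub {K : Finset κ} {x : κ → ℝ} (h₀ : ∀ k, 0 ≤ x k)
    (h₁ : ∀ k, x k ≤ 1) : 1 - ∑ k ∈ K, x k ≤ ∏ k ∈ K, (1 - x k) := by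
  classical
  induction K using Finset.induction_on with
  | empty => simp
  | insert a K ha ih =>
    rw [Finset.sum_insert ha, Finset.prod_insert ha]
    nlinarith [h₀ a, h₁ a, mul_le_mul_of_nonneg_left ih (sub_nonneg.2 (h₁ a)),
      mul_nonneg (h₀ a) (Finset.sum_nonneg fun k (_ : k ∈ K) => h₀ k)]

/-- The Lovász Local Lemma, for `[0, 1]`-valued functions in place of events. -/
lemma exists_subset_forall_ne_one (hp₀ : 0 ≤ p) (hp₁ : p ≤ 1) [Fintype κ]
    {a : κ → Finset ι → ℝ} {T : κ → Finset ι} {q : ℝ} {D : ℕ}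
    (ha₀ : ∀ k U, 0 ≤ a k U) (ha₁ : ∀ k U, a k U ≤ 1)
    (haT : ∀ k U, a k (U ∩ T k) = a k U)
    (hq : ∀ k, randomSubsetExp s p (a k) ≤ q)
    (hD : ∀ k, (Finset.univ.filter fun j => ¬ Disjoint (T k) (T j)).card ≤ D)
    (hD₁ : 1 ≤ D) (hq₀ : 0 ≤ q) (hqD : 4 * q * D ≤ 1) :
    ∃ U ⊆ s, ∀ k, a k U ≠ 1 := by
  classical
  have hb₀ (K : Finset κ) (U) : 0 ≤ ∏ k ∈ K, (1 - a k U) :=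
    Finset.prod_nonneg fun k _ => sub_nonneg.2 (ha₁ k U)
  have hb₁ (K : Finset κ) (U) : ∏ k ∈ K, (1 - a k U) ≤ 1 :=
    Finset.prod_le_one (fun k _ => sub_nonneg.2 (ha₁ k U)) fun k _ => by linarith [ha₀ k U]
  have hE₀ (K : Finset κ) : 0 ≤ randomSubsetExp s p (fun U => ∏ k ∈ K, (1 - a k U)) :=
    (randomSubsetExp_const 0).symm.trans_le (randomSubsetExp_mono hp₀ hp₁ fun U _ => hb₀ K U)
  have key (n : ℕ) : ∀ K : Finset κ, K.card = n → ∀ i,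
      randomSubsetExp s p (fun U => a i U * ∏ k ∈ K, (1 - a k U)) ≤
        2 * q * randomSubsetExp s p (fun U => ∏ k ∈ K, (1 - a k U)) := by
    induction n using Nat.strong_induction_on with
    | _ n ih =>
    intro K hK i
    set K₁ := K.filter fun j => ¬ Disjoint (T i) (T j) with hK₁
    set K₂ := K.filter fun j => Disjoint (T i) (T j) with hK₂
    have hsplit (U) : ∏ k ∈ K, (1 - a k U) =
        (∏ k ∈ K₂, (1 - a k U)) * ∏ k ∈ K₁, (1 - a k U) :=
      (Finset.prod_filter_mul_prod_filter_not K _ _).symm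
    have hindep : randomSubsetExp s p (fun U => a i U * ∏ k ∈ K₂, (1 - a k U)) =
        randomSubsetExp s p (a i) * randomSubsetExp s p (fun U => ∏ k ∈ K₂, (1 - a k U)) := by
      refine randomSubsetExp_mul (T i) (haT i) fun U => Finset.prod_congr rfl fun k hk => ?_
      rw [apply_sdiff_of_disjoint (haT k) (Finset.mem_filter.1 hk).2]
    have hle : randomSubsetExp s p (fun U => a i U * ∏ k ∈ K, (1 - a k U)) ≤
        q * randomSubsetExp s p (fun U => ∏ k ∈ K₂, (1 - a k U)) :=
      calc _ ≤ randomSubsetExp s p (fun U => a i U * ∏ k ∈ K₂, (1 - a k U)) := by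
            refine randomSubsetExp_mono hp₀ hp₁ fun U _ => ?_
            rw [hsplit]
            exact mul_le_mul_of_nonneg_left (mul_le_of_le_one_right (hb₀ _ U) (hb₁ _ U)) (ha₀ i U)
        _ ≤ _ := hindep.trans_le (mul_le_mul_of_nonneg_right (hq i) (hE₀ _))
    suffices randomSubsetExp s p (fun U => ∏ k ∈ K₂, (1 - a k U)) ≤
        2 * randomSubsetExp s p (fun U => ∏ k ∈ K, (1 - a k U)) by
      linarith [mul_le_mul_of_nonneg_left this hq₀]
    rcases K₁.eq_empty_or_nonempty with hempty | hne
    · simp only [hsplit, hempty, Finset.prod_empty, mul_one]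
      linarith [hE₀ K₂]
    have hcard : K₂.card < n := by
      have : K₂.card + K₁.card = K.card := Finset.card_filter_add_card_filter_not _
      have := hne.card_pos
      omega
    have hK₁D : (K₁.card : ℝ) ≤ D := by
      exact_mod_cast (Finset.card_le_card (Finset.filter_subset_filter _
        (Finset.subset_univ K))).trans (hD i)
    have hlow : randomSubsetExp s p (fun U => ∏ k ∈ K₂, (1 - a k U)) -
        ∑ j ∈ K₁, randomSubsetExp s p (fun U => a j U * ∏ k ∈ K₂, (1 - a k U)) ≤
        randomSubsetExp s p (fun U => ∏ k ∈ K, (1 - a k U)) := by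
      rw [← randomSubsetExp_sum, ← randomSubsetExp_sub]
      refine randomSubsetExp_mono hp₀ hp₁ fun U _ => ?_
      rw [hsplit, ← Finset.sum_mul]
      linarith [mul_le_mul_of_nonneg_left (one_sub_sum_le_prod_one_sub (K := K₁)
        (fun k => ha₀ k U) fun k => ha₁ k U) (hb₀ K₂ U)]
    have hsum := Finset.sum_le_card_nsmul K₁ _ _ fun j _ => ih _ hcard K₂ rfl j
    rw [nsmul_eq_mul] at hsum
    nlinarith [mul_le_mul_of_nonneg_right hK₁D (mul_nonneg hq₀ (hE₀ K₂)),
      mul_le_mul_of_nonneg_right hqD (hE₀ K₂)]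
  have hq_lt : 2 * q < 1 := by
    have : (1 : ℝ) ≤ D := by exact_mod_cast hD₁
    nlinarith
  have hpos (K : Finset κ) : 0 < randomSubsetExp s p (fun U => ∏ k ∈ K, (1 - a k U)) := by
    induction K using Finset.induction_on with
    | empty => simp [randomSubsetExp_const]
    | insert i K hi ih =>
      simp only [Finset.prod_insert hi, one_sub_mul, randomSubsetExp_sub]
      nlinarith [key _ K rfl i]
  by_contra! h
  have hzero : randomSubsetExp s p (fun U => ∏ k, (1 - a k U)) ≤ 0 := by
    refine (randomSubsetExp_mono hp₀ hp₁ fun U hU => ?_).trans_eq (randomSubsetExp_const 0)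
    obtain ⟨k, hk⟩ := h U hU
    exact (Finset.prod_eq_zero (Finset.mem_univ k) (by simp [hk])).le
  exact (hpos Finset.univ).not_ge hzero

lemma randomSubsetExp_notMem_mem {e f : ι} (he : e ∈ s) (hf : f ∈ s) (hef : e ≠ f) :
    randomSubsetExp s p (fun U => if e ∉ U ∧ f ∈ U then 1 else 0) = (1 - p) * p := by
  have h₁ : randomSubsetExp s p (fun U => 1 - if e ∈ U then 1 else 0) = 1 - p := by
    rw [randomSubsetExp_sub, randomSubsetExp_const, randomSubsetExp_mem he]
  have h₂ : randomSubsetExp s p (fun U => if f ∈ U then 1 else 0) = p := randomSubsetExp_mem hf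
  refine Eq.trans ?_ ((randomSubsetExp_mul (s := s) (p := p) {e}
    (f := fun U => 1 - if e ∈ U then 1 else 0) (g := fun U => if f ∈ U then 1 else 0)
    ?_ ?_).trans (by rw [h₁, h₂]))
  · congr 1
    ext U
    by_cases h : e ∈ U <;> simp [h]
  · simp
  · simp [hef.symm]

lemma exp_half_le : Real.exp (1 / 2) ≤ 1.65 := by
  have h : Real.exp (1 / 2) ^ 2 = Real.exp 1 := by
    rw [← Real.exp_nat_mul]
    norm_num
  nlinarith [Real.exp_one_lt_d9, Real.exp_pos (1 / 2)]

lemma exp_neg_half_le : Real.exp (-(1 / 2)) ≤ 0.61 := by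
  have h : Real.exp (1 / 2) ^ 2 = Real.exp 1 := by
    rw [← Real.exp_nat_mul]
    norm_num
  have h₁ : (1 / 0.61 : ℝ) ≤ Real.exp (1 / 2) := by
    by_contra! hlt
    nlinarith [Real.exp_one_gt_d9, Real.exp_pos (1 / 2)]
  rw [Real.exp_neg, inv_le_comm₀ (Real.exp_pos _) (by norm_num)]
  norm_num at h₁ ⊢
  exact h₁

section Tails

variable {m l : ℝ} {A : Finset ι}

lemma randomSubsetExp_card_inter_lt (hl : 1 ≤ l) (hlm : l ≤ m / 10000) (hA : A ⊆ s)
    (hAm : m / 4 ≤ A.card) :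
    randomSubsetExp s (l / m) (fun U => if ((U ∩ A).card : ℝ) < 1 / 8 * l then 1 else 0) ≤
      Real.exp (-(l / 100)) := by
  have hm : 0 < m := by linarith
  have hp₀ : 0 ≤ l / m := by positivity
  have hp₁ : l / m ≤ 1 := (div_le_one hm).2 (by linarith)
  have hpA : l / 4 ≤ l / m * A.card :=
    calc l / 4 = l / m * (m / 4) := by field_simp
      _ ≤ _ := mul_le_mul_of_nonneg_left hAm hp₀
  refine (randomSubsetExp_mono hp₀ hp₁ fun U _ => ?_).trans
    ((randomSubsetExp_chernoff (K := A) (X := fun e U => e ∈ U) (T := fun e => {e}) (r := l / m)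
      hp₀ hp₁ (by simp) (by simp [Set.PairwiseDisjoint, Set.Pairwise])
      (fun e he => randomSubsetExp_mem (hA he)) hp₀ hp₁ (-(1 / 2)) (1 / 8 * l)).trans
      (Real.exp_le_exp.2 ?_))
  · rw [Finset.filter_mem_eq_inter, Finset.inter_comm A U]
    split_ifs <;> linarith
  · nlinarith [exp_neg_half_le]

lemma randomSubsetExp_lt_card_inter (hl : 1 ≤ l) (hlm : l ≤ m / 10000) (hA : A ⊆ s)
    (hAm : A.card ≤ m) :
    randomSubsetExp s (l / m) (fun U => if 3 / 2 * l < ((U ∩ A).card : ℝ) then 1 else 0) ≤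
      Real.exp (-(l / 100)) := by
  have hm : 0 < m := by linarith
  have hp₀ : 0 ≤ l / m := by positivity
  have hp₁ : l / m ≤ 1 := (div_le_one hm).2 (by linarith)
  have hpA : l / m * A.card ≤ l :=
    calc _ ≤ l / m * m := mul_le_mul_of_nonneg_left hAm hp₀
      _ = l := by field_simp
  refine (randomSubsetExp_mono hp₀ hp₁ fun U _ => ?_).trans
    ((randomSubsetExp_chernoff (K := A) (X := fun e U => e ∈ U) (T := fun e => {e}) (r := l / m)
      hp₀ hp₁ (by simp) (by simp [Set.PairwiseDisjoint, Set.Pairwise])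
      (fun e he => randomSubsetExp_mem (hA he)) hp₀ hp₁ (1 / 2) (3 / 2 * l)).trans
      (Real.exp_le_exp.2 ?_))
  · rw [Finset.filter_mem_eq_inter, Finset.inter_comm A U]
    split_ifs <;> linarith
  · have : 1 ≤ Real.exp (1 / 2) := Real.one_le_exp (by norm_num)
    nlinarith [exp_half_le]

variable {β : Type*} [DecidableEq β] {B : Finset ι} {c : ι → β}

lemma card_filter_notMem_image_le (hcA : Set.InjOn c A) (U : Finset ι) :
    (A.filter fun e => c e ∉ B.image c).card ≤
      ((A \ U).image c \ (B \ U).image c).card + (U ∩ A).card := by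
  rw [← Finset.card_image_of_injOn (hcA.mono (Finset.coe_subset.2
    (Finset.filter_subset (fun e => c e ∉ B.image c) A)))]
  refine (Finset.card_le_card (t := ((A \ U).image c \ (B \ U).image c) ∪ (U ∩ A).image c)
    ?_).trans ((Finset.card_union_le _ _).trans (Nat.add_le_add_left Finset.card_image_le _))
  intro x hx
  simp only [Finset.mem_image, Finset.mem_filter, Finset.mem_union, Finset.mem_sdiff,
    Finset.mem_inter] at hx ⊢
  grind

/-- If `U ∩ A` is not too large, the colours surviving on `A` but not on `B` are many. -/
lemma randomSubsetExp_card_palette_sdiff_lt (hl : 1 ≤ l) (hlm : l ≤ m / 10000) (hA : A ⊆ s)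
    (hB : B ⊆ s) (hAB : (A ∩ B).card ≤ 1) (hcA : Set.InjOn c A) (hcB : Set.InjOn c B)
    (hAm : m / 4 ≤ A.card) :
    randomSubsetExp s (l / m) (fun U => if ((U ∩ A).card : ℝ) ≤ 3 / 2 * l ∧
        (((A \ U).image c \ (B \ U).image c).card : ℝ) < 1 / 16 * l then 1 else 0) ≤
      Real.exp (-(l / 100)) := by
  have hm : 0 < m := by linarith
  have hp₀ : 0 ≤ l / m := by positivity
  have hp₁ : l / m ≤ 1 / 10000 := (div_le_iff₀ hm).2 (by linarith)
  by_cases hlarge : 2 * l ≤ ((A.filter fun e => c e ∉ B.image c).card : ℝ)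
  · refine (randomSubsetExp_mono hp₀ (by linarith) (g := fun _ => 0) fun U _ => ?_).trans
      ((randomSubsetExp_const 0).trans_le (Real.exp_pos _).le)
    have : ((A.filter fun e => c e ∉ B.image c).card : ℝ) ≤
        ((A \ U).image c \ (B \ U).image c).card + (U ∩ A).card := by
      exact_mod_cast card_filter_notMem_image_le hcA U
    split_ifs with h
    · linarith [h.1, h.2]
    · rfl
  set K := (A \ B).filter fun e => c e ∈ B.image c with hK
  have hKm : m / 5 ≤ K.card := by
    have hcard : A.card ≤ (A.filter fun e => c e ∉ B.image c).card + K.card + (A ∩ B).card := by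
      rw [← Finset.card_filter_add_card_filter_not (s := A) fun e => c e ∉ B.image c, add_assoc]
      refine Nat.add_le_add_left ((Finset.card_le_card ?_).trans (Finset.card_union_le _ _)) _
      intro e
      simp only [hK, Finset.mem_filter, Finset.mem_union, Finset.mem_sdiff, Finset.mem_inter]
      tauto
    have : (A.card : ℝ) ≤ (A.filter fun e => c e ∉ B.image c).card + K.card + 1 := by
      exact_mod_cast hcard.trans (Nat.add_le_add_left hAB _)
    linarith
  have hpartner : ∀ e, ∃ f, e ∈ K → f ∈ B ∧ c f = c e := by
    intro e
    by_cases he : e ∈ K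
    · obtain ⟨f, hf⟩ := Finset.mem_image.1 (Finset.mem_filter.1 he).2
      exact ⟨f, fun _ => hf⟩
    · exact ⟨e, fun h => absurd h he⟩
  choose φ hφ using hpartner
  have hKA {e} (he : e ∈ K) : e ∈ A := (Finset.mem_sdiff.1 (Finset.mem_filter.1 he).1).1
  have hKB {e} (he : e ∈ K) : e ∉ B := (Finset.mem_sdiff.1 (Finset.mem_filter.1 he).1).2
  have hne {e f} (he : e ∈ K) (hf : f ∈ K) : e ≠ φ f :=
    fun h => hKB he (h ▸ (hφ f hf).1)
  have hcount (U : Finset ι) : (K.filter fun e => e ∉ U ∧ φ e ∈ U).card ≤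
      ((A \ U).image c \ (B \ U).image c).card := by
    refine Finset.card_le_card_of_injOn c (fun e he => ?_) fun e he f hf hef => ?_
    · obtain ⟨heK, heU, hφU⟩ := Finset.mem_filter.1 he
      refine Finset.mem_coe.2 (Finset.mem_sdiff.2 ⟨Finset.mem_image_of_mem c
        (Finset.mem_sdiff.2 ⟨hKA heK, heU⟩), fun h => ?_⟩)
      obtain ⟨f, hf, hfe⟩ := Finset.mem_image.1 h
      obtain ⟨hfB, hfU⟩ := Finset.mem_sdiff.1 hf
      exact hfU (hcB hfB (hφ e heK).1 (hfe.trans (hφ e heK).2.symm) ▸ hφU)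
    · exact hcA (hKA (Finset.mem_filter.1 he).1) (hKA (Finset.mem_filter.1 hf).1) hef
  have hdisj : (K : Set ι).PairwiseDisjoint fun e => ({e, φ e} : Finset ι) := by
    intro e he f hf hef
    have hφne : φ e ≠ φ f := fun h =>
      hef (hcA (hKA he) (hKA hf) (by rw [← (hφ e he).2, ← (hφ f hf).2, h]))
    have := hne he hf
    have := hne hf he
    simp only [Function.onFun, Finset.disjoint_left]
    grind
  refine (randomSubsetExp_mono hp₀ (by linarith) fun U _ => ?_).trans
    ((randomSubsetExp_chernoff (K := K) (X := fun e U => e ∉ U ∧ φ e ∈ U)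
      (T := fun e => {e, φ e}) (r := (1 - l / m) * (l / m)) hp₀ (by linarith) (by simp) hdisj
      (fun e he => randomSubsetExp_notMem_mem (hA (hKA he)) (hB (hφ e he).1) (hne he he))
      (mul_nonneg (by linarith) hp₀) (by nlinarith) (-(1 / 2)) (1 / 16 * l)).trans
      (Real.exp_le_exp.2 ?_))
  · have : ((K.filter fun e => e ∉ U ∧ φ e ∈ U).card : ℝ) ≤
        ((A \ U).image c \ (B \ U).image c).card := by
      exact_mod_cast hcount U
    split_ifs with h₁ h₂ h₂
    · rfl
    · exact absurd (by linarith [h₁.2]) h₂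
    · exact zero_le_one
    · rfl
  · have hmean : 0.19 * l ≤ (1 - l / m) * (l / m) * K.card :=
      calc 0.19 * l ≤ (1 - l / m) * (l / 5) := by nlinarith
        _ = (1 - l / m) * (l / m) * (m / 5) := by field_simp
        _ ≤ _ := mul_le_mul_of_nonneg_left hKm (mul_nonneg (by linarith) hp₀)
    nlinarith [exp_neg_half_le]

end Tails

end RandomSubset

namespace SimpleGraph

variable {V : Type*} [Fintype V] [DecidableEq V] (G : SimpleGraph V) [DecidableRel G.Adj]

/-- The edges incident with `v` or with a neighbour of `v`. -/
def nearbyEdges (v : V) : Finset (Sym2 V) :=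
  (insert v (G.neighborFinset v)).biUnion fun u => G.incidenceFinset u

variable {G}

lemma card_insert_neighborFinset_le (v : V) :
    (insert v (G.neighborFinset v)).card ≤ G.maxDegree + 1 :=
  (Finset.card_insert_le _ _).trans (Nat.add_le_add_right (G.degree_le_maxDegree v) 1)

lemma mem_insert_neighborFinset_comm {u v : V} :
    u ∈ insert v (G.neighborFinset v) ↔ v ∈ insert u (G.neighborFinset u) := by
  simp [eq_comm, G.adj_comm]

lemma mem_insert_neighborFinset_of_mem_incidenceFinset {u v : V} {e : Sym2 V}
    (hu : e ∈ G.incidenceFinset u) (hv : e ∈ G.incidenceFinset v) :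
    v ∈ insert u (G.neighborFinset u) := by
  rw [mem_incidenceFinset] at hu hv
  by_cases h : u = v
  · simp [h]
  · simpa using Or.inr (G.adj_of_mem_incidenceSet h hu hv)

lemma card_filter_not_disjoint_nearbyEdges_le (v : V) :
    (Finset.univ.filter fun w => ¬ Disjoint (G.nearbyEdges v) (G.nearbyEdges w)).card ≤
      (G.maxDegree + 1) ^ 3 := by
  let N : V → Finset V := fun v => insert v (G.neighborFinset v)
  have hN (x : V) : (N x).card ≤ G.maxDegree + 1 := card_insert_neighborFinset_le x
  have hN_biUnion (S : Finset V) : (S.biUnion N).card ≤ S.card * (G.maxDegree + 1) :=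
    Finset.card_biUnion_le_card_mul _ _ _ fun x _ => hN x
  calc _ ≤ (((N v).biUnion N).biUnion N).card := by
        refine Finset.card_le_card fun w hw => ?_
        obtain ⟨e, hev, hew⟩ := Finset.not_disjoint_iff.1 (Finset.mem_filter.1 hw).2
        obtain ⟨x, hx, hex⟩ := Finset.mem_biUnion.1 hev
        obtain ⟨y, hy, hey⟩ := Finset.mem_biUnion.1 hew
        exact Finset.mem_biUnion.2 ⟨y, Finset.mem_biUnion.2 ⟨x, hx,
          mem_insert_neighborFinset_of_mem_incidenceFinset hex hey⟩,
          mem_insert_neighborFinset_comm.1 hy⟩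
    _ ≤ (G.maxDegree + 1) * (G.maxDegree + 1) * (G.maxDegree + 1) :=
        (hN_biUnion _).trans (Nat.mul_le_mul_right _
          ((hN_biUnion _).trans (Nat.mul_le_mul_right _ (hN v))))
    _ = (G.maxDegree + 1) ^ 3 := by ring

lemma card_incidenceFinset_inter_le_one {u v : V} (h : u ≠ v) :
    (G.incidenceFinset u ∩ G.incidenceFinset v).card ≤ 1 := by
  refine (Finset.card_le_card (t := {s(u, v)}) fun e he => ?_).trans_eq
    (Finset.card_singleton _)
  simp only [Finset.mem_inter, mem_incidenceFinset] at he
  simpa using G.incidenceSet_inter_incidenceSet_subset h he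

lemma incidenceFinset_subset_nearbyEdges {u v : V} (h : u ∈ insert v (G.neighborFinset v)) :
    G.incidenceFinset u ⊆ G.nearbyEdges v :=
  Finset.subset_biUnion_of_mem (fun u => G.incidenceFinset u) h

lemma inter_nearbyEdges_inter_incidenceFinset {u v : V}
    (h : u ∈ insert v (G.neighborFinset v)) (U : Finset (Sym2 V)) :
    (U ∩ G.nearbyEdges v) ∩ G.incidenceFinset u = U ∩ G.incidenceFinset u := by
  rw [Finset.inter_assoc, Finset.inter_eq_right.2 (incidenceFinset_subset_nearbyEdges h)]

lemma incidenceFinset_sdiff_inter_nearbyEdges {u v : V}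
    (h : u ∈ insert v (G.neighborFinset v)) (U : Finset (Sym2 V)) :
    G.incidenceFinset u \ (U ∩ G.nearbyEdges v) = G.incidenceFinset u \ U := by
  have := incidenceFinset_subset_nearbyEdges h
  grind

section Uncolouring

variable {β : Type*} [DecidableEq β]

/-- `U` fails at `v` with parameter `l` if it contains too few or too many edges at `v`, or if
some neighbour's partial palette contains too much of the partial palette of `v`. -/
def IsBadUncolouring (G : SimpleGraph V) [DecidableRel G.Adj] (c : Sym2 V → β) (l : ℝ) (v : V)
    (U : Finset (Sym2 V)) : Prop :=
  ((U ∩ G.incidenceFinset v).card : ℝ) < 1 / 8 * l ∨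
  3 / 2 * l < ((U ∩ G.incidenceFinset v).card : ℝ) ∨
  ∃ u ∈ G.neighborFinset v, ((U ∩ G.incidenceFinset v).card : ℝ) ≤ 3 / 2 * l ∧
    ((((G.incidenceFinset v \ U).image c) \ ((G.incidenceFinset u \ U).image c)).card : ℝ) <
      1 / 16 * l

variable {c : Sym2 V → β} {l : ℝ}

lemma isBadUncolouring_inter_nearbyEdges (v : V) (U : Finset (Sym2 V)) :
    G.IsBadUncolouring c l v (U ∩ G.nearbyEdges v) ↔ G.IsBadUncolouring c l v U := by
  have hv : v ∈ insert v (G.neighborFinset v) := Finset.mem_insert_self _ _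
  simp only [IsBadUncolouring, inter_nearbyEdges_inter_incidenceFinset hv,
    incidenceFinset_sdiff_inter_nearbyEdges hv]
  refine or_congr_right (or_congr_right (exists_congr fun u => and_congr_right fun hu => ?_))
  rw [incidenceFinset_sdiff_inter_nearbyEdges (Finset.mem_insert_of_mem hu)]

open Classical in
lemma randomSubsetExp_isBadUncolouring_le (hl : 1 ≤ l) (hlm : l ≤ (G.maxDegree : ℝ) / 10000)
    (hδ : ∀ v, (G.maxDegree : ℝ) / 4 ≤ G.degree v)
    (hc : ∀ v, Set.InjOn c (G.incidenceFinset v)) (v : V) :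
    randomSubsetExp G.edgeFinset (l / G.maxDegree)
        (fun U => if G.IsBadUncolouring c l v U then 1 else 0) ≤
      (G.maxDegree + 2) * Real.exp (-(l / 100)) := by
  have hm : (0 : ℝ) < G.maxDegree := by linarith
  have hp₁ : l / G.maxDegree ≤ 1 := (div_le_one hm).2 (by linarith)
  have hsub (u : V) : G.incidenceFinset u ⊆ G.edgeFinset := G.incidenceFinset_subset u
  have hdeg (u : V) : (G.maxDegree : ℝ) / 4 ≤ (G.incidenceFinset u).card := by
    rw [card_incidenceFinset_eq_degree]
    exact hδ u
  have hdeg' : ((G.incidenceFinset v).card : ℝ) ≤ G.maxDegree := by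
    rw [card_incidenceFinset_eq_degree]
    exact_mod_cast G.degree_le_maxDegree v
  let low : Finset (Sym2 V) → ℝ := fun U =>
    if ((U ∩ G.incidenceFinset v).card : ℝ) < 1 / 8 * l then 1 else 0
  let high : Finset (Sym2 V) → ℝ := fun U =>
    if 3 / 2 * l < ((U ∩ G.incidenceFinset v).card : ℝ) then 1 else 0
  let close : V → Finset (Sym2 V) → ℝ := fun u U =>
    if ((U ∩ G.incidenceFinset v).card : ℝ) ≤ 3 / 2 * l ∧
      ((((G.incidenceFinset v \ U).image c) \ ((G.incidenceFinset u \ U).image c)).card : ℝ) <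
        1 / 16 * l then 1 else 0
  have hlow₀ (U) : 0 ≤ low U := by positivity
  have hhigh₀ (U) : 0 ≤ high U := by positivity
  have hclose₀ (u U) : 0 ≤ close u U := by positivity
  have hclose : ∀ u ∈ G.neighborFinset v,
      randomSubsetExp G.edgeFinset (l / G.maxDegree) (close u) ≤ Real.exp (-(l / 100)) := by
    intro u hu
    exact randomSubsetExp_card_palette_sdiff_lt hl hlm (hsub v) (hsub u)
      (card_incidenceFinset_inter_le_one ((G.mem_neighborFinset v u).1 hu).ne) (hc v) (hc u)
      (hdeg v)
  calc _ ≤ randomSubsetExp G.edgeFinset (l / G.maxDegree)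
          (fun U => low U + (high U + ∑ u ∈ G.neighborFinset v, close u U)) := by
        refine randomSubsetExp_mono (by positivity) hp₁ fun U _ => ?_
        have hsum₀ : 0 ≤ ∑ u ∈ G.neighborFinset v, close u U :=
          Finset.sum_nonneg fun u _ => hclose₀ u U
        split_ifs with h
        · rcases h with h | h | ⟨u, hu, h⟩
          · have : low U = 1 := if_pos h
            linarith [hhigh₀ U]
          · have : high U = 1 := if_pos h
            linarith [hlow₀ U]
          · have : close u U = 1 := if_pos h
            linarith [hlow₀ U, hhigh₀ U,
              Finset.single_le_sum (f := fun u => close u U) (fun u _ => hclose₀ u U) hu]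
        · linarith [hlow₀ U, hhigh₀ U]
    _ ≤ Real.exp (-(l / 100)) +
          (Real.exp (-(l / 100)) + G.maxDegree * Real.exp (-(l / 100))) := by
        rw [randomSubsetExp_add, randomSubsetExp_add, randomSubsetExp_sum]
        refine add_le_add (randomSubsetExp_card_inter_lt hl hlm (hsub v) (hdeg v))
          (add_le_add (randomSubsetExp_lt_card_inter hl hlm (hsub v) hdeg') ?_)
        refine (Finset.sum_le_card_nsmul _ _ _ hclose).trans ?_
        rw [nsmul_eq_mul]
        gcongr
        exact G.degree_le_maxDegree v
    _ = _ := by ring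

lemma exists_forall_not_isBadUncolouring (hl : 1 ≤ l) (hlm : l ≤ (G.maxDegree : ℝ) / 10000)
    (hexp : 4 * ((G.maxDegree + 2) * Real.exp (-(l / 100))) * ((G.maxDegree : ℝ) + 1) ^ 3 ≤ 1)
    (hδ : ∀ v, (G.maxDegree : ℝ) / 4 ≤ G.degree v)
    (hc : ∀ v, Set.InjOn c (G.incidenceFinset v)) :
    ∃ U ⊆ G.edgeFinset, ∀ v, ¬ G.IsBadUncolouring c l v U := by
  classical
  have hm : (0 : ℝ) < G.maxDegree := by linarith
  obtain ⟨U, hU, h⟩ := exists_subset_forall_ne_one (s := G.edgeFinset) (p := l / G.maxDegree)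
    (a := fun v U => if G.IsBadUncolouring c l v U then 1 else 0) (T := G.nearbyEdges)
    (by positivity) ((div_le_one hm).2 (by linarith))
    (fun v U => by positivity) (fun v U => by split_ifs <;> norm_num)
    (fun v U => by simp only [isBadUncolouring_inter_nearbyEdges])
    (randomSubsetExp_isBadUncolouring_le hl hlm hδ hc)
    card_filter_not_disjoint_nearbyEdges_le (Nat.one_le_pow _ _ (Nat.succ_pos _))
    (by positivity) (by exact_mod_cast hexp)
  exact ⟨U, hU, fun v hv => h v (if_pos hv)⟩

end Uncolouring

end SimpleGraph

lemma log_sq_le_div {m : ℝ} (h : 1000 ≤ Real.log m) (hm : 0 < m) :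
    Real.log m ^ 2 ≤ m / 10000 := by
  have := Real.pow_div_factorial_le_exp (Real.log m) (by linarith) 4
  rw [Real.exp_log hm] at this
  norm_num [Nat.factorial] at this
  nlinarith [pow_le_pow_left₀ (by norm_num) h 2, sq_nonneg (Real.log m)]

lemma mul_exp_neg_log_sq_le_one {m : ℝ} (h : 1000 ≤ Real.log m) (hm : 2 ≤ m) :
    4 * ((m + 2) * Real.exp (-(Real.log m ^ 2 / 100))) * (m + 1) ^ 3 ≤ 1 := by
  have hpow : m ^ 10 ≤ Real.exp (Real.log m ^ 2 / 100) := by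
    rw [← Real.exp_log (show 0 < m ^ 10 by positivity), Real.log_pow]
    refine Real.exp_le_exp.2 ?_
    push_cast
    nlinarith
  have hm₁ : 1 ≤ m := by linarith
  have hpoly : 4 * (m + 2) * (m + 1) ^ 3 ≤ m ^ 10 :=
    calc 4 * (m + 2) * (m + 1) ^ 3 ≤ 4 * (m + m) * (m + m) ^ 3 := by gcongr
      _ = 2 ^ 6 * m ^ 4 := by ring
      _ ≤ m ^ 6 * m ^ 4 := by gcongr
      _ = m ^ 10 := by ring
  rw [Real.exp_neg]
  have := Real.exp_pos (Real.log m ^ 2 / 100)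
  calc _ = 4 * (m + 2) * (m + 1) ^ 3 / Real.exp (Real.log m ^ 2 / 100) := by ring
    _ ≤ 1 := (div_le_one this).2 (hpoly.trans hpow)

/-- (Claim 2 of the paper.) There is a constant `Δ₀` such that for every finite simple
graph `G` with maximum degree `Δ ≥ Δ₀` and minimum degree `δ ≥ Δ/4` and every proper
edge colouring `c` of `G`, one can uncolour a set `U` of edges so that
`(1/8)(log Δ)² ≤ |U ∩ E(v)| ≤ (3/2)(log Δ)²` for every vertex `v`, and the partial
palettes of any two adjacent vertices of equal degree have symmetric difference of size
at least `(1/16)(log Δ)²`. -/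
theorem uncolouring_edges :
    ∃ Δ₀ : ℕ,
      ∀ (V β : Type) [Fintype V] [DecidableEq V] [DecidableEq β]
        (G : SimpleGraph V) [DecidableRel G.Adj] (c : Sym2 V → β),
        -- maximum degree at least Δ₀
        Δ₀ ≤ G.maxDegree →
        -- minimum degree at least Δ/4
        (∀ v : V, (G.maxDegree : ℝ) / 4 ≤ (G.degree v : ℝ)) →
        -- c is a proper edge colouring of G
        (∀ e ∈ G.edgeFinset, ∀ f ∈ G.edgeFinset,
          e ≠ f → (∃ w : V, w ∈ e ∧ w ∈ f) → c e ≠ c f) →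
        ∃ U : Finset (Sym2 V), U ⊆ G.edgeFinset ∧
          -- (iii) each vertex loses neither too few nor too many edges
          (∀ v : V,
            (1 / 8 : ℝ) * (Real.log (G.maxDegree)) ^ 2 ≤
                (((U ∩ G.incidenceFinset v).card : ℝ)) ∧
              (((U ∩ G.incidenceFinset v).card : ℝ)) ≤
                (3 / 2 : ℝ) * (Real.log (G.maxDegree)) ^ 2) ∧
          -- (iv) partial palettes of adjacent vertices of equal degree differ a lot
          (∀ u v : V, G.Adj u v → G.degree u = G.degree v →
            (1 / 16 : ℝ) * (Real.log (G.maxDegree)) ^ 2 ≤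
              ((((((G.incidenceFinset u) \ U).image c ∪ ((G.incidenceFinset v) \ U).image c) \
                (((G.incidenceFinset u) \ U).image c ∩
                  ((G.incidenceFinset v) \ U).image c)).card : ℝ))) := by
  refine ⟨⌈Real.exp 1000⌉₊, fun V β _ _ _ G _ c hΔ hδ hc => ?_⟩
  have hexp : Real.exp 1000 ≤ G.maxDegree := Nat.ceil_le.1 hΔ
  have hm : (0 : ℝ) < G.maxDegree := (Real.exp_pos _).trans_le hexp
  have hlog : 1000 ≤ Real.log G.maxDegree := (Real.le_log_iff_exp_le hm).2 hexp
  have hm₂ : (2 : ℝ) ≤ G.maxDegree := by linarith [Real.add_one_le_exp 1000]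
  have hinj (v : V) : Set.InjOn c (G.incidenceFinset v) := by
    intro e he f hf hef
    by_contra hne
    refine hc e (G.incidenceFinset_subset v he) f (G.incidenceFinset_subset v hf) hne
      ⟨v, ?_, ?_⟩ hef
    · exact ((G.mem_incidenceFinset v e).1 he).2
    · exact ((G.mem_incidenceFinset v f).1 hf).2
  obtain ⟨U, hU, hgood⟩ := SimpleGraph.exists_forall_not_isBadUncolouring
    (l := Real.log G.maxDegree ^ 2) (by nlinarith) (log_sq_le_div hlog hm)
    (mul_exp_neg_log_sq_le_one hlog hm₂) hδ hinj
  have hle (v : V) := not_lt.1 fun h => hgood v (Or.inl h)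
  have hge (v : V) := not_lt.1 fun h => hgood v (Or.inr (Or.inl h))
  refine ⟨U, hU, fun v => ⟨hle v, hge v⟩, fun u v huv _ => ?_⟩
  refine (not_lt.1 fun h => hgood u (Or.inr (Or.inr
    ⟨v, (G.mem_neighborFinset u v).2 huv, hge u, h⟩))).trans ?_
  exact_mod_cast Finset.card_le_card (by grind)
end

section
/- There exists a constant Δ₀ such that the following holds. Let G = (V,E) be a finite simple graph with maximum degree Δ ≥ Δ₀ and minimum degree δ ≥ Δ/4. Let U ⊆ E and let c be a proper edge colouring of E ∖ U such that: (1/8)·(log Δ)² ≤ |U ∩ E(v)| ≤ (3/2)·(log Δ)² for every v ∈ V; |S_u △ S_v| ≥ (1/16)·(log Δ)² for every edge uv with d(u) = d(v), where S_v = {c(e) : e ∈ E(v) ∖ U}; and each edge e ∈ U has a finite list R_e with |R_e| ≥ (1/2)·(log Δ)^8 such that no colour of R_e equals c(f) for any edge f ∈ E ∖ U adjacent to e. Then there exist a set U' ⊆ U and a choice c'(e) ∈ R_e for each e ∈ U ∖ U' such that the combined colouring (c on E ∖ U and c' on U ∖ U') is a proper edge colouring of E ∖ U', |U' ∩ E(v)|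 ≤ (1/128)·(log Δ)² for every v ∈ V, and |S'_u △ S'_v| ≥ (1/32)·(log Δ)² for every edge uv with d(u) = d(v), where S'_v denotes the partial palette of v under the combined colouring. -/
/-- If every set of a weighted family has at most `s` elements, then at most `s / ε` points of `R`
are contained in sets whose total weight exceeds an `ε`-fraction of the whole weight. -/
lemma card_filter_heavy_le {ι β : Type*} [DecidableEq β] (N : Finset ι) (D : ι → Finset β)
    (w : ι → ℝ) (hw : ∀ v ∈ N, 0 ≤ w v) {s ε : ℝ} (hε : 0 < ε)
    (hs : ∀ v ∈ N, ((D v).card : ℝ) ≤ s) (hs0 : 0 ≤ s) (R : Finset β) :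
    ((R.filter fun x => ε * ∑ v ∈ N, w v < ∑ v ∈ N, if x ∈ D v then w v else 0).card : ℝ)
      ≤ s / ε := by
  set B := R.filter fun x => ε * ∑ v ∈ N, w v < ∑ v ∈ N, if x ∈ D v then w v else 0 with hB
  rcases (Finset.sum_nonneg hw).eq_or_lt with h0 | hpos
  · have hBe : B = ∅ := by
      refine Finset.filter_eq_empty_iff.2 fun x _ => ?_
      have hle : (∑ v ∈ N, if x ∈ D v then w v else 0) ≤ ∑ v ∈ N, w v :=
        Finset.sum_le_sum fun v hv => by
          split_ifs
          exacts [le_rfl, hw v hv]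
      rw [not_lt, ← h0, mul_zero]
      exact hle.trans_eq h0.symm
    rw [hBe]
    simp only [Finset.card_empty, Nat.cast_zero]
    positivity
  · have h1 : (B.card : ℝ) * (ε * ∑ v ∈ N, w v)
        ≤ ∑ x ∈ B, ∑ v ∈ N, if x ∈ D v then w v else 0 := by
      rw [← nsmul_eq_mul]
      exact Finset.card_nsmul_le_sum _ _ _ fun x hx => (Finset.mem_filter.1 hx).2.le
    have h2 : (∑ x ∈ B, ∑ v ∈ N, if x ∈ D v then w v else 0) ≤ s * ∑ v ∈ N, w v := by
      rw [Finset.sum_comm, Finset.mul_sum]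
      refine Finset.sum_le_sum fun v hv => ?_
      rw [← Finset.sum_filter, Finset.sum_const, nsmul_eq_mul]
      refine mul_le_mul_of_nonneg_right (le_trans ?_ (hs v hv)) (hw v hv)
      exact_mod_cast Finset.card_le_card fun x hx => (Finset.mem_filter.1 hx).2
    rw [le_div_iff₀ hε]
    exact le_of_mul_le_mul_right (by linarith) hpos

/-- Greedy list edge colouring that controls, for every vertex `u` and every set `D u v` with
`v ∈ N u`, the number of edges at `u` whose colour lies in `D u v`. The control is through the
exponential potential `∑ v ∈ N u, 2 ^ (number of such edges)`. -/
lemma exists_proper_list_colouring_potential_le {V β : Type*} [DecidableEq V] [DecidableEq β]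
    (N : V → Finset V) (D : V → V → Finset β) {s ε m : ℝ} (hε : 0 < ε) (hs0 : 0 ≤ s)
    (hs : ∀ u, ∀ v ∈ N u, ((D u v).card : ℝ) ≤ s)
    (R : Sym2 V → Finset β) (c : Sym2 V → β) (W : Finset (Sym2 V))
    (hm : ∀ u, ((W.filter fun e => u ∈ e).card : ℝ) ≤ m)
    (hR : ∀ e ∈ W, 2 * m + 2 * (s / ε) < ((R e).card : ℝ)) :
    ∃ f : Sym2 V → β, (∀ e ∈ W, f e ∈ R e) ∧
      (∀ e ∈ W, ∀ e' ∈ W, e ≠ e' → (∃ w, w ∈ e ∧ w ∈ e') → f e ≠ f e') ∧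
      ∀ u, ∑ v ∈ N u, (2 : ℝ) ^ (W.filter fun e => u ∈ e ∧ f e ∈ D u v).card
        ≤ (N u).card * (1 + ε) ^ (W.filter fun e => u ∈ e).card := by
  induction W using Finset.induction_on with
  | empty => exact ⟨c, by simp, by simp, by simp⟩
  | insert e W he ih =>
    obtain ⟨f, hfR, hfp, hfΦ⟩ := ih
      (fun u => le_trans (by
        exact_mod_cast Finset.card_le_card
          (Finset.filter_subset_filter _ (Finset.subset_insert e W))) (hm u))
      (fun e' he' => hR e' (Finset.mem_insert_of_mem he'))
    let w : V → V → ℝ := fun u v => 2 ^ (W.filter fun e => u ∈ e ∧ f e ∈ D u v).card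
    let B : V → Finset β := fun u =>
      (R e).filter fun x => ε * ∑ v ∈ N u, w u v < ∑ v ∈ N u, if x ∈ D u v then w u v else 0
    let C : V → Finset β := fun u => (W.filter fun e => u ∈ e).image f
    have hB : ∀ u, ((B u).card : ℝ) ≤ s / ε := fun u =>
      card_filter_heavy_le (N u) (D u) (w u) (fun v _ => by positivity) hε (hs u) hs0 (R e)
    have hC : ∀ u, ((C u).card : ℝ) ≤ m := fun u => by
      refine le_trans ?_ (hm u)
      exact_mod_cast Finset.card_image_le.trans (Finset.card_le_card
        (Finset.filter_subset_filter _ (Finset.subset_insert e W)))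
    obtain ⟨x, hxR, hx⟩ : ∃ x ∈ R e, ∀ u ∈ e, x ∉ B u ∧ x ∉ C u := by
      induction e using Sym2.ind with
      | _ a b =>
        have hlt : ((B a ∪ C a) ∪ (B b ∪ C b)).card < (R s(a, b)).card := by
          have h1 := Finset.card_union_le (B a ∪ C a) (B b ∪ C b)
          have h2 := Finset.card_union_le (B a) (C a)
          have h3 := Finset.card_union_le (B b) (C b)
          have h4 : ((((B a ∪ C a) ∪ (B b ∪ C b)).card : ℕ) : ℝ)
              ≤ (B a).card + (C a).card + ((B b).card + (C b).card) := by
            exact_mod_cast h1.trans (add_le_add h2 h3)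
          have h5 := hR s(a, b) (Finset.mem_insert_self _ _)
          have := hB a
          have := hB b
          have := hC a
          have := hC b
          exact_mod_cast (by linarith : ((((B a ∪ C a) ∪ (B b ∪ C b)).card : ℕ) : ℝ)
            < ((R s(a, b)).card : ℝ))
        obtain ⟨x, hxR, hx⟩ := Finset.exists_mem_notMem_of_card_lt_card hlt
        simp only [Finset.mem_union, not_or] at hx
        refine ⟨x, hxR, fun u hu => ?_⟩
        rcases Sym2.mem_iff.1 hu with rfl | rfl
        · exact hx.1
        · exact hx.2
    have hne : ∀ e' ∈ W, e' ≠ e := fun e' he' h => he (h ▸ he')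
    have hup : ∀ e' ∈ W, Function.update f e x e' = f e' := fun e' he' =>
      Function.update_of_ne (hne e' he') _ _
    have hxC : ∀ e' ∈ W, (∃ w, w ∈ e ∧ w ∈ e') → x ≠ f e' := by
      rintro e' he' ⟨u, hu, hu'⟩ rfl
      exact (hx u hu).2 (Finset.mem_image_of_mem f (Finset.mem_filter.2 ⟨he', hu'⟩))
    refine ⟨Function.update f e x, ?_, ?_, ?_⟩
    · intro e' he'
      rcases Finset.mem_insert.1 he' with rfl | he'
      · simpa using hxR
      · rw [hup e' he']
        exact hfR e' he'
    · intro e₁ h₁ e₂ h₂ h12 hadj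
      rcases Finset.mem_insert.1 h₁ with rfl | h₁W <;>
        rcases Finset.mem_insert.1 h₂ with rfl | h₂W
      · exact absurd rfl h12
      · rw [hup e₂ h₂W, Function.update_self]
        exact hxC e₂ h₂W hadj
      · rw [hup e₁ h₁W, Function.update_self]
        exact (hxC e₁ h₁W (hadj.imp fun _ h => h.symm)).symm
      · rw [hup e₁ h₁W, hup e₂ h₂W]
        exact hfp e₁ h₁W e₂ h₂W h12 hadj
    · intro u
      have hcongr : ∀ v, (W.filter fun e' => u ∈ e' ∧ Function.update f e x e' ∈ D u v)
          = W.filter fun e' => u ∈ e' ∧ f e' ∈ D u v := fun v =>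
        Finset.filter_congr fun e' he' => by rw [hup e' he']
      by_cases hu : u ∈ e
      · have hstep : ∀ v, (2 : ℝ) ^ ((insert e W).filter fun e' =>
            u ∈ e' ∧ Function.update f e x e' ∈ D u v).card
            = w u v + if x ∈ D u v then w u v else 0 := by
          intro v
          rw [Finset.filter_insert, hcongr v]
          by_cases hxD : x ∈ D u v
          · rw [if_pos (by simp [hu, hxD]), if_pos hxD,
              Finset.card_insert_of_notMem (by simp [he]), pow_succ]
            simp only [w]
            ring
          · rw [if_neg (by simp [hxD]), if_neg hxD, add_zero]
        have hxB : (∑ v ∈ N u, if x ∈ D u v then w u v else 0) ≤ ε * ∑ v ∈ N u, w u v := by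
          by_contra! h
          exact (hx u hu).1 (Finset.mem_filter.2 ⟨hxR, h⟩)
        simp only [hstep]
        rw [Finset.sum_add_distrib, Finset.filter_insert, if_pos hu,
          Finset.card_insert_of_notMem (by simp [he]), pow_succ]
        have h1 : ∑ v ∈ N u, w u v ≤ _ := hfΦ u
        nlinarith [mul_le_mul_of_nonneg_right h1 (by linarith : (0 : ℝ) ≤ 1 + ε)]
      · simp only [Finset.filter_insert, hu, false_and, if_false]
        simp only [hcongr]
        exact hfΦ u

/-- Enlarging `A` by `X` and `B` by `Y` destroys only those elements of the symmetric difference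
that lie in `X` or in `Y`. -/
lemma card_symmDiff_le_card_symmDiff_union {β : Type*} [DecidableEq β] (A B X Y : Finset β) :
    ((A ∪ B) \ (A ∩ B)).card ≤
      (((A ∪ X) ∪ (B ∪ Y)) \ ((A ∪ X) ∩ (B ∪ Y))).card
        + (X ∩ ((A ∪ B) \ (A ∩ B))).card + (Y ∩ ((A ∪ B) \ (A ∩ B))).card := by
  refine le_trans (Finset.card_le_card ?_) ((Finset.card_union_le _ _).trans
    (Nat.add_le_add_right (Finset.card_union_le _ _) _))
  intro x
  simp only [Finset.mem_union, Finset.mem_sdiff, Finset.mem_inter]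
  tauto

/-- An exponent is small compared with `L ^ 2` if the corresponding power of two is at most a
constant multiple of `exp L`. -/
lemma natCast_le_sq_div_of_two_pow_le {L : ℝ} (hL : 1000 ≤ L) {k n : ℕ}
    (hn : (n : ℝ) ≤ 3 / 2 * L ^ 2)
    (h : (2 : ℝ) ^ k ≤ Real.exp L * (1 + 1 / L ^ 2) ^ n) : (k : ℝ) ≤ L ^ 2 / 64 := by
  have hL2 : 0 < L ^ 2 := by positivity
  have h1 : (1 + 1 / L ^ 2) ^ n ≤ Real.exp (3 / 2) := by
    calc (1 + 1 / L ^ 2) ^ n ≤ Real.exp (1 / L ^ 2) ^ n := by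
          refine pow_le_pow_left₀ (by positivity) ?_ n
          linarith [Real.add_one_le_exp (1 / L ^ 2)]
      _ = Real.exp (n * (1 / L ^ 2)) := (Real.exp_nat_mul _ _).symm
      _ ≤ Real.exp (3 / 2) := by
          refine Real.exp_le_exp.2 ?_
          rw [mul_one_div, div_le_iff₀ hL2]
          exact hn
  have h2 : (2 : ℝ) ^ k ≤ Real.exp (L + 3 / 2) := by
    rw [Real.exp_add]
    exact h.trans (mul_le_mul_of_nonneg_left h1 (Real.exp_pos L).le)
  have h3 : (k : ℝ) * Real.log 2 ≤ L + 3 / 2 := by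
    rw [← Real.log_pow, Real.log_le_iff_le_exp (by positivity)]
    exact h2
  have h4 : (1 / 2 : ℝ) < Real.log 2 := by linarith [Real.log_two_gt_d9]
  nlinarith [mul_le_mul_of_nonneg_left h4.le (Nat.cast_nonneg k : (0 : ℝ) ≤ (k : ℝ))]


/-- (Claim 3 of the paper.) There is a constant `Δ₀` such that the following holds for
every finite simple graph `G` with maximum degree `Δ ≥ Δ₀` and minimum degree `δ ≥ Δ/4`.
Suppose `U ⊆ E` is a set of uncoloured edges, `c` is a proper edge colouring of `E ∖ U`
with `(1/8)(log Δ)² ≤ |U ∩ E(v)| ≤ (3/2)(log Δ)²` for every vertex `v`, and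
`|S_u △ S_v| ≥ (1/16)(log Δ)²` for every edge `uv` with `d(u) = d(v)`, and every edge
`e ∈ U` has a list `R_e` of size at least `(1/2)(log Δ)^8` whose colours avoid the
colours of the coloured edges adjacent to `e`. Then there are `U' ⊆ U` and a colouring
`c''` extending `c` by colours of the reserved lists on `U ∖ U'` which is proper on
`E ∖ U'`, with `|U' ∩ E(v)| ≤ (1/128)(log Δ)²` for every vertex `v` and
`|S'_u △ S'_v| ≥ (1/32)(log Δ)²` for every edge `uv` with `d(u) = d(v)`. -/
theorem colouring_with_reserved_colours :
    ∃ Δ₀ : ℕ,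
      ∀ (V β : Type) [Fintype V] [DecidableEq V] [DecidableEq β]
        (G : SimpleGraph V) [DecidableRel G.Adj]
        (U : Finset (Sym2 V)) (c : Sym2 V → β) (R : Sym2 V → Finset β),
        -- maximum degree at least Δ₀
        Δ₀ ≤ G.maxDegree →
        -- minimum degree at least Δ/4
        (∀ v : V, (G.maxDegree : ℝ) / 4 ≤ (G.degree v : ℝ)) →
        U ⊆ G.edgeFinset →
        -- c is a proper edge colouring of E ∖ U
        (∀ e ∈ G.edgeFinset \ U, ∀ f ∈ G.edgeFinset \ U,
          e ≠ f → (∃ w : V, w ∈ e ∧ w ∈ f) → c e ≠ c f) →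
        -- each vertex has neither too few nor too many uncoloured edges
        (∀ v : V,
          (1 / 8 : ℝ) * (Real.log (G.maxDegree)) ^ 2 ≤
              (((U ∩ G.incidenceFinset v).card : ℝ)) ∧
            (((U ∩ G.incidenceFinset v).card : ℝ)) ≤
              (3 / 2 : ℝ) * (Real.log (G.maxDegree)) ^ 2) →
        -- partial palettes of adjacent vertices of equal degree differ a lot
        (∀ u v : V, G.Adj u v → G.degree u = G.degree v →
          (1 / 16 : ℝ) * (Real.log (G.maxDegree)) ^ 2 ≤
            ((((((G.incidenceFinset u) \ U).image c ∪ ((G.incidenceFinset v) \ U).image c) \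
              (((G.incidenceFinset u) \ U).image c ∩
                ((G.incidenceFinset v) \ U).image c)).card : ℝ))) →
        -- the reserved lists are long
        (∀ e ∈ U,
          (1 / 2 : ℝ) * (Real.log (G.maxDegree)) ^ 8 ≤ ((R e).card : ℝ)) →
        -- the reserved colours avoid the colours of adjacent coloured edges
        (∀ e ∈ U, ∀ f ∈ G.edgeFinset \ U,
          e ≠ f → (∃ w : V, w ∈ e ∧ w ∈ f) → c f ∉ R e) →
        ∃ (U' : Finset (Sym2 V)) (c'' : Sym2 V → β),
          U' ⊆ U ∧
          -- c'' agrees with c on the previously coloured edges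
          (∀ e ∈ G.edgeFinset \ U, c'' e = c e) ∧
          -- newly coloured edges get reserved colours
          (∀ e ∈ U \ U', c'' e ∈ R e) ∧
          -- c'' is a proper edge colouring of E ∖ U'
          (∀ e ∈ G.edgeFinset \ U', ∀ f ∈ G.edgeFinset \ U',
            e ≠ f → (∃ w : V, w ∈ e ∧ w ∈ f) → c'' e ≠ c'' f) ∧
          -- (v) few edges remain uncoloured at each vertex
          (∀ v : V,
            (((U' ∩ G.incidenceFinset v).card : ℝ)) ≤
              (1 / 128 : ℝ) * (Real.log (G.maxDegree)) ^ 2) ∧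
          -- (vi) partial palettes of adjacent vertices of equal degree still differ a lot
          (∀ u v : V, G.Adj u v → G.degree u = G.degree v →
            (1 / 32 : ℝ) * (Real.log (G.maxDegree)) ^ 2 ≤
              ((((((G.incidenceFinset u) \ U').image c'' ∪
                  ((G.incidenceFinset v) \ U').image c'') \
                (((G.incidenceFinset u) \ U').image c'' ∩
                  ((G.incidenceFinset v) \ U').image c'')).card : ℝ))) := by
  refine ⟨⌈Real.exp 1000⌉₊, ?_⟩
  intro V β _ _ _ G _ U c R hΔ _ hUE hc hU hD hR hRc
  set L := Real.log (G.maxDegree : ℝ) with hLdef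
  have hΔ' : Real.exp 1000 ≤ (G.maxDegree : ℝ) := Nat.ceil_le.1 hΔ
  have hΔpos : (0 : ℝ) < G.maxDegree := (Real.exp_pos _).trans_le hΔ'
  have hL : 1000 ≤ L := (Real.le_log_iff_exp_le hΔpos).2 hΔ'
  have hexpL : Real.exp L = G.maxDegree := Real.exp_log hΔpos
  have hL2 : 0 < L ^ 2 := by positivity
  have hinc : ∀ u, (U.filter fun e => u ∈ e) = U ∩ G.incidenceFinset u := by
    intro u
    ext e
    simp only [Finset.mem_filter, Finset.mem_inter, SimpleGraph.mem_incidenceFinset,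
      SimpleGraph.incidenceSet, Set.mem_sep_iff]
    exact and_congr_right fun he =>
      (and_iff_right (SimpleGraph.mem_edgeFinset.1 (hUE he))).symm
  let S : V → Finset β := fun u => (G.incidenceFinset u \ U).image c
  let D : V → V → Finset β := fun u v => (S u ∪ S v) \ (S u ∩ S v)
  let N : V → Finset V := fun u =>
    (G.neighborFinset u).filter fun v => ((D u v).card : ℝ) ≤ 4 * L ^ 2
  have hNcard : ∀ u, ((N u).card : ℝ) ≤ Real.exp L := by
    intro u
    rw [hexpL]
    exact_mod_cast (Finset.card_filter_le _ _).trans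
      ((G.card_neighborFinset_eq_degree u).le.trans (G.degree_le_maxDegree u))
  have hdeg : ∀ u, ((U.filter fun e => u ∈ e).card : ℝ) ≤ 3 / 2 * L ^ 2 := fun u => by
    rw [hinc u]
    exact (hU u).2
  obtain ⟨f, hfR, hfp, hfΦ⟩ := exists_proper_list_colouring_potential_le N D
    (s := 4 * L ^ 2) (ε := 1 / L ^ 2) (m := 3 / 2 * L ^ 2) (by positivity) (by positivity)
    (fun u v hv => (Finset.mem_filter.1 hv).2) R c U hdeg (fun e he => by
      refine lt_of_lt_of_le ?_ (hR e he)
      have hLL : 1000000 ≤ L ^ 2 := by nlinarith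
      have h4 : 4 * L ^ 2 / (1 / L ^ 2) = 4 * (L ^ 2) ^ 2 := by field_simp
      rw [h4, show L ^ 8 = (L ^ 2) ^ 2 * (L ^ 2) ^ 2 by ring]
      nlinarith [mul_le_mul hLL hLL (by norm_num) hL2.le, sq_nonneg (L ^ 2)])
  have hfew : ∀ u, ∀ v ∈ N u,
      ((U.filter fun e => u ∈ e ∧ f e ∈ D u v).card : ℝ) ≤ L ^ 2 / 64 := by
    intro u v hv
    refine natCast_le_sq_div_of_two_pow_le hL (hdeg u) ?_
    refine (Finset.single_le_sum (f := fun v =>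
      (2 : ℝ) ^ (U.filter fun e => u ∈ e ∧ f e ∈ D u v).card)
      (fun v _ => by positivity) hv).trans ((hfΦ u).trans ?_)
    exact mul_le_mul_of_nonneg_right (hNcard u) (by positivity)
  let X : V → Finset β := fun u => (U.filter fun e => u ∈ e).image f
  have hXcard : ∀ u, ((X u).card : ℝ) ≤ 3 / 2 * L ^ 2 := fun u =>
    le_trans (by exact_mod_cast Finset.card_image_le) (hdeg u)
  have hXD : ∀ u v, (X u ∩ D u v).card ≤ (U.filter fun e => u ∈ e ∧ f e ∈ D u v).card := by
    intro u v
    refine le_trans (Finset.card_le_card ?_)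
      (Finset.card_image_le (s := U.filter fun e => u ∈ e ∧ f e ∈ D u v) (f := f))
    intro x hx
    obtain ⟨hxX, hxD⟩ := Finset.mem_inter.1 hx
    obtain ⟨e, he, rfl⟩ := Finset.mem_image.1 hxX
    obtain ⟨heU, hue⟩ := Finset.mem_filter.1 he
    exact Finset.mem_image_of_mem f (Finset.mem_filter.2 ⟨heU, hue, hxD⟩)
  have hDcomm : ∀ u v, D u v = D v u := fun u v => by
    simp only [D, Finset.union_comm (S u), Finset.inter_comm (S u)]
  let c' : Sym2 V → β := fun e => if e ∈ U then f e else c e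
  have hpal : ∀ u, (G.incidenceFinset u \ ∅).image c' = S u ∪ X u := by
    intro u
    have hsplit : G.incidenceFinset u \ ∅
        = (G.incidenceFinset u \ U) ∪ (U.filter fun e => u ∈ e) := by
      rw [hinc u, Finset.sdiff_empty, Finset.inter_comm, Finset.sdiff_union_inter]
    rw [hsplit, Finset.image_union]
    congr 1
    · exact Finset.image_congr fun e he => if_neg (Finset.mem_sdiff.1 he).2
    · exact Finset.image_congr fun e he => if_pos (Finset.mem_filter.1 he).1
  refine ⟨∅, c', Finset.empty_subset _, ?_, ?_, ?_, ?_, ?_⟩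
  · exact fun e he => if_neg (Finset.mem_sdiff.1 he).2
  · intro e he
    have heU := (Finset.mem_sdiff.1 he).1
    simp only [c', if_pos heU]
    exact hfR e heU
  · intro e he e' he' hne hadj
    rw [Finset.sdiff_empty] at he he'
    by_cases h : e ∈ U <;> by_cases h' : e' ∈ U <;> simp only [c', h, h', if_true, if_false]
    · exact hfp e h e' h' hne hadj
    · exact fun heq => hRc e h e' (Finset.mem_sdiff.2 ⟨he', h'⟩) hne hadj (heq ▸ hfR e h)
    · exact fun heq => hRc e' h' e (Finset.mem_sdiff.2 ⟨he, h⟩) hne.symm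
        (hadj.imp fun _ h => h.symm) (heq ▸ hfR e' h')
    · exact hc e (Finset.mem_sdiff.2 ⟨he, h⟩) e' (Finset.mem_sdiff.2 ⟨he', h'⟩) hne hadj
  · intro v
    rw [Finset.empty_inter, Finset.card_empty, Nat.cast_zero]
    positivity
  · intro u v huv hdeq
    rw [hpal u, hpal v]
    have hloss : ((D u v).card : ℝ) ≤
        ((((S u ∪ X u) ∪ (S v ∪ X v)) \ ((S u ∪ X u) ∩ (S v ∪ X v))).card : ℝ)
          + (X u ∩ D u v).card + (X v ∩ D u v).card := by
      exact_mod_cast card_symmDiff_le_card_symmDiff_union (S u) (S v) (X u) (X v)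
    by_cases hsmall : ((D u v).card : ℝ) ≤ 4 * L ^ 2
    · have hDuv : 1 / 16 * L ^ 2 ≤ ((D u v).card : ℝ) := hD u v huv hdeq
      have hu : ((X u ∩ D u v).card : ℝ) ≤ L ^ 2 / 64 :=
        le_trans (by exact_mod_cast hXD u v)
          (hfew u v (Finset.mem_filter.2 ⟨(G.mem_neighborFinset u v).2 huv, hsmall⟩))
      have hv : ((X v ∩ D u v).card : ℝ) ≤ L ^ 2 / 64 := by
        rw [hDcomm u v] at hsmall ⊢
        exact le_trans (by exact_mod_cast hXD v u)
          (hfew v u (Finset.mem_filter.2 ⟨(G.mem_neighborFinset v u).2 huv.symm, hsmall⟩))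
      linarith
    · have hu : ((X u ∩ D u v).card : ℝ) ≤ 3 / 2 * L ^ 2 :=
        le_trans (by exact_mod_cast Finset.card_le_card Finset.inter_subset_left) (hXcard u)
      have hv : ((X v ∩ D u v).card : ℝ) ≤ 3 / 2 * L ^ 2 :=
        le_trans (by exact_mod_cast Finset.card_le_card Finset.inter_subset_left) (hXcard v)
      linarith
end

section
/- Let G = (V,E) be a finite simple graph with maximum degree Δ ≥ 1 and without isolated edges, and assign to each edge e a finite list L_e with |L_e| ≥ 4Δ − 3. Then there exists a proper edge colouring c of G with c(e) ∈ L_e for every edge e such that S_c(u) ≠ S_c(v) for every edge uv of G. In particular ch'_a(G) ≤ 4Δ − 3. -/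
/-- At most one colour outside `P` completes `P` to `Q`. -/
theorem exists_forall_insert_ne {β : Type*} [DecidableEq β] [Nonempty β] (P Q : Finset β) :
    ∃ d, ∀ x, x ∉ P → x ≠ d → insert x P ≠ Q := by
  by_cases h : ∃ d, d ∉ P ∧ insert d P = Q
  · obtain ⟨d, -, rfl⟩ := h
    refine ⟨d, fun x hx hxd heq => ?_⟩
    have : x ∈ insert d P := heq ▸ Finset.mem_insert_self x P
    simp_all
  · push Not at h
    exact ⟨Classical.arbitrary β, fun x hx _ => h x hx⟩

theorem image_update_of_mem {α β : Type*} [DecidableEq α] [DecidableEq β] (c : α → β)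
    {s : Finset α} {a : α} (ha : a ∈ s) (x : β) :
    s.image (Function.update c a x) = insert x ((s.erase a).image c) := by
  conv_lhs => rw [← Finset.insert_erase ha, Finset.image_insert, Function.update_self]
  congr 1
  refine Finset.image_congr fun b hb => Function.update_of_ne ?_ _ _
  exact Finset.ne_of_mem_erase hb

theorem image_update_of_notMem {α β : Type*} [DecidableEq α] [DecidableEq β] (c : α → β)
    {s : Finset α} {a : α} (ha : a ∉ s) (x : β) :
    s.image (Function.update c a x) = s.image c := by
  refine Finset.image_congr fun b hb => Function.update_of_ne ?_ _ _
  rintro rfl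
  exact ha hb

namespace SimpleGraph

variable {V β : Type*} [Fintype V] [DecidableEq V] [DecidableEq β]
  (G : SimpleGraph V) [DecidableRel G.Adj]

/-- The edges of `G` other than `f` that share a vertex with `f`. -/
def adjacentEdges (f : Sym2 V) : Finset (Sym2 V) :=
  G.edgeFinset.filter fun h => h ≠ f ∧ ∃ w, w ∈ h ∧ w ∈ f

variable {G}

theorem mem_adjacentEdges {f h : Sym2 V} :
    h ∈ G.adjacentEdges f ↔ h ∈ G.edgeFinset ∧ h ≠ f ∧ ∃ w, w ∈ h ∧ w ∈ f := by
  simp [adjacentEdges]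

theorem mem_incidenceFinset_iff {v : V} {e : Sym2 V} :
    e ∈ G.incidenceFinset v ↔ e ∈ G.edgeFinset ∧ v ∈ e := by
  simp [incidenceSet]

theorem card_adjacentEdges_le {f : Sym2 V} (hf : f ∈ G.edgeFinset) :
    (G.adjacentEdges f).card ≤ 2 * (G.maxDegree - 1) := by
  induction f using Sym2.ind with | _ a b
  have hsub : G.adjacentEdges s(a, b) ⊆
      (G.incidenceFinset a).erase s(a, b) ∪ (G.incidenceFinset b).erase s(a, b) := by
    intro h hh
    obtain ⟨he, hne, w, hw, hwf⟩ := mem_adjacentEdges.1 hh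
    rcases Sym2.mem_iff.1 hwf with rfl | rfl <;>
      simp only [Finset.mem_union, Finset.mem_erase, mem_incidenceFinset_iff] <;> tauto
  have hcard : ∀ v ∈ s(a, b),
      ((G.incidenceFinset v).erase s(a, b)).card ≤ G.maxDegree - 1 := by
    intro v hv
    rw [Finset.card_erase_of_mem (mem_incidenceFinset_iff.2 ⟨hf, hv⟩),
      G.card_incidenceFinset_eq_degree]
    exact Nat.sub_le_sub_right (G.degree_le_maxDegree v) 1
  have ha := hcard a (by simp)
  have hb := hcard b (by simp)
  have := (Finset.card_le_card hsub).trans (Finset.card_union_le _ _)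
  omega

/-- The palettes of `u` and `v` differ when the edge `uv` is disregarded. -/
def Distinguishes (G : SimpleGraph V) [DecidableRel G.Adj] (c : Sym2 V → β) (u v : V) : Prop :=
  ((G.incidenceFinset u).erase s(u, v)).image c ≠ ((G.incidenceFinset v).erase s(u, v)).image c

theorem Distinguishes.symm {c : Sym2 V → β} {u v : V} (h : G.Distinguishes c u v) :
    G.Distinguishes c v u := by
  unfold Distinguishes at *
  rw [Sym2.eq_swap]
  exact h.symm

/-- When `f` is recoloured, each edge adjacent to `f` rules out at most one colour. -/
theorem exists_forall_distinguishes_update [Nonempty β] (c : Sym2 V → β) {f g : Sym2 V}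
    (hf : f ∈ G.edgeFinset) (hg : g ∈ G.adjacentEdges f) :
    ∃ d, ∀ x, (∀ h ∈ G.adjacentEdges f, x ≠ c h) → x ≠ d →
      ∀ u v, g = s(u, v) → G.Distinguishes (Function.update c f x) u v := by
  obtain ⟨-, hgf, p, hpg, hpf⟩ := mem_adjacentEdges.1 hg
  obtain ⟨q, rfl⟩ := Sym2.mem_iff_exists.1 hpg
  have hpq : p ≠ q := by
    have := (mem_adjacentEdges.1 hg).1
    rw [mem_edgeFinset, mem_edgeSet] at this
    exact this.ne
  have hqf : q ∉ f := fun hqf => hgf ((Sym2.mem_and_mem_iff hpq).1 ⟨hpf, hqf⟩).symm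
  obtain ⟨d, hd⟩ := exists_forall_insert_ne
    ((((G.incidenceFinset p).erase s(p, q)).erase f).image c)
    (((G.incidenceFinset q).erase s(p, q)).image c)
  refine ⟨d, fun x hx hxd => ?_⟩
  have key : G.Distinguishes (Function.update c f x) p q := by
    unfold Distinguishes
    rw [image_update_of_mem c, image_update_of_notMem c]
    · refine hd x ?_ hxd
      simp only [Finset.mem_image, Finset.mem_erase, mem_incidenceFinset_iff]
      rintro ⟨h, ⟨hhf, -, hh, hph⟩, rfl⟩
      exact hx h (mem_adjacentEdges.2 ⟨hh, hhf, p, hph, hpf⟩) rfl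
    · exact fun h => hqf (mem_incidenceFinset_iff.1 (Finset.mem_of_mem_erase h)).2
    · exact Finset.mem_erase.2 ⟨hgf.symm, mem_incidenceFinset_iff.2 ⟨hf, hpf⟩⟩
  intro u v huv
  rcases Sym2.eq_iff.1 huv with ⟨rfl, rfl⟩ | ⟨rfl, rfl⟩
  · exact key
  · exact key.symm

/-- Every set `F` of edges can be coloured properly from the lists so that adjacent vertices all
of whose other edges lie in `F` are distinguished. -/
theorem exists_partial_colouring [Nonempty β] (L : Sym2 V → Finset β)
    (hΔ : 1 ≤ G.maxDegree)
    (hiso : ∀ u v : V, G.Adj u v → 1 < G.degree u ∨ 1 < G.degree v)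
    (hL : ∀ e ∈ G.edgeFinset, 4 * G.maxDegree - 3 ≤ (L e).card)
    (F : Finset (Sym2 V)) (hF : F ⊆ G.edgeFinset) :
    ∃ c : Sym2 V → β,
      (∀ e ∈ F, c e ∈ L e) ∧
      (∀ e ∈ F, ∀ f ∈ F, e ≠ f → (∃ w : V, w ∈ e ∧ w ∈ f) → c e ≠ c f) ∧
      (∀ u v : V, G.Adj u v → (G.incidenceFinset u).erase s(u, v) ⊆ F →
        (G.incidenceFinset v).erase s(u, v) ⊆ F → G.Distinguishes c u v) := by
  induction F using Finset.induction_on with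
  | empty =>
    refine ⟨fun _ => Classical.arbitrary β, by simp, by simp, fun u v huv hu hv => ?_⟩
    have hcard : ∀ w ∈ s(u, v), (G.incidenceFinset w).erase s(u, v) ⊆ ∅ → G.degree w ≤ 1 := by
      intro w hw h
      have h1 := Finset.card_le_card h
      rw [Finset.card_erase_of_mem (mem_incidenceFinset_iff.2 ⟨by simpa using huv, hw⟩),
        G.card_incidenceFinset_eq_degree, Finset.card_empty] at h1
      omega
    have h1 := hcard u (by simp) hu
    have h2 := hcard v (by simp) hv
    have := hiso u v huv
    omega
  | insert f F hfF ih =>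
    obtain ⟨c, hc, hprop, hdist⟩ := ih ((Finset.subset_insert _ _).trans hF)
    have hf : f ∈ G.edgeFinset := hF (Finset.mem_insert_self _ _)
    choose! d hd using fun g (hg : g ∈ G.adjacentEdges f) =>
      exists_forall_distinguishes_update c hf hg
    obtain ⟨x, hxL, hx⟩ : ∃ x ∈ L f,
        x ∉ (G.adjacentEdges f).image c ∪ (G.adjacentEdges f).image d := by
      apply Finset.exists_mem_notMem_of_card_lt_card
      have h1 := Finset.card_union_le ((G.adjacentEdges f).image c) ((G.adjacentEdges f).image d)
      have h2 : ((G.adjacentEdges f).image c).card ≤ _ := Finset.card_image_le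
      have h3 : ((G.adjacentEdges f).image d).card ≤ _ := Finset.card_image_le
      have h4 := card_adjacentEdges_le hf
      have h5 := hL f hf
      omega
    have hxc : ∀ h ∈ G.adjacentEdges f, x ≠ c h := by
      rintro h hh rfl
      exact hx (Finset.mem_union_left _ (Finset.mem_image_of_mem c hh))
    have hxd : ∀ h ∈ G.adjacentEdges f, x ≠ d h := by
      rintro h hh rfl
      exact hx (Finset.mem_union_right _ (Finset.mem_image_of_mem d hh))
    have hne : ∀ e ∈ F, e ≠ f := fun e he h => hfF (h ▸ he)
    have hupd : ∀ e ∈ F, Function.update c f x e = c e := fun e he =>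
      Function.update_of_ne (hne e he) _ _
    have hFe : ∀ e ∈ F, e ∈ G.edgeFinset := fun e he => hF (Finset.mem_insert_of_mem he)
    refine ⟨Function.update c f x, ?_, ?_, ?_⟩
    · intro e he
      rcases Finset.mem_insert.1 he with rfl | he
      · simpa using hxL
      · rw [hupd e he]
        exact hc e he
    · intro e he e' he' hee ⟨w, hw, hw'⟩
      rcases Finset.mem_insert.1 he with rfl | heF <;>
        rcases Finset.mem_insert.1 he' with rfl | heF'
      · exact absurd rfl hee
      · rw [hupd e' heF', Function.update_self]
        exact hxc e' (mem_adjacentEdges.2 ⟨hFe e' heF', hne e' heF', w, hw', hw⟩)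
      · rw [hupd e heF, Function.update_self]
        exact (hxc e (mem_adjacentEdges.2 ⟨hFe e heF, hne e heF, w, hw, hw'⟩)).symm
      · rw [hupd e heF, hupd e' heF']
        exact hprop e heF e' heF' hee ⟨w, hw, hw'⟩
    · intro u v huv hu hv
      by_cases hg : s(u, v) ∈ G.adjacentEdges f
      · exact hd _ hg x hxc (hxd _ hg) u v rfl
      · have hnot : ∀ w ∈ s(u, v), f ∉ (G.incidenceFinset w).erase s(u, v) := by
          intro w hw hfw
          obtain ⟨h1, h2⟩ := Finset.mem_erase.1 hfw
          exact hg (mem_adjacentEdges.2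
            ⟨by simpa using huv, h1.symm, w, hw, (mem_incidenceFinset_iff.1 h2).2⟩)
        have hnu := hnot u (by simp)
        have hnv := hnot v (by simp)
        have := hdist u v huv ((Finset.subset_insert_iff_of_notMem hnu).1 hu)
          ((Finset.subset_insert_iff_of_notMem hnv).1 hv)
        unfold Distinguishes at *
        rwa [image_update_of_notMem c hnu, image_update_of_notMem c hnv]

end SimpleGraph


/-- (Greedy colouring for small maximum degree, Section 3 of the paper.) Every finite
simple graph `G` with maximum degree `Δ ≥ 1` and without isolated edges admits an
adjacent vertex distinguishing edge colouring from any lists of size at least `4Δ − 3`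
on the edges; in particular `ch'_a(G) ≤ 4Δ − 3`. -/
theorem avd_greedy_bound
    (V β : Type) [Fintype V] [DecidableEq V] [DecidableEq β]
    (G : SimpleGraph V) [DecidableRel G.Adj] (L : Sym2 V → Finset β)
    (hΔ : 1 ≤ G.maxDegree)
    -- no isolated edges
    (hiso : ∀ u v : V, G.Adj u v → 1 < G.degree u ∨ 1 < G.degree v)
    -- lists are large enough
    (hL : ∀ e ∈ G.edgeFinset, 4 * G.maxDegree - 3 ≤ (L e).card) :
    ∃ c : Sym2 V → β,
      -- colours chosen from the lists
      (∀ e ∈ G.edgeFinset, c e ∈ L e) ∧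
      -- proper edge colouring
      (∀ e ∈ G.edgeFinset, ∀ f ∈ G.edgeFinset,
        e ≠ f → (∃ w : V, w ∈ e ∧ w ∈ f) → c e ≠ c f) ∧
      -- adjacent vertices have distinct palettes
      (∀ u v : V, G.Adj u v →
        (G.incidenceFinset u).image c ≠ (G.incidenceFinset v).image c) := by
  obtain ⟨e, he⟩ : G.edgeFinset.Nonempty := by
    rw [Finset.nonempty_iff_ne_empty]
    intro h
    have : G.maxDegree ≤ 0 := by
      refine G.maxDegree_le_of_forall_degree_le 0 fun v => ?_
      rw [← G.card_incidenceFinset_eq_degree, ← Finset.card_empty, ← h]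
      exact Finset.card_le_card fun e he => (SimpleGraph.mem_incidenceFinset_iff.1 he).1
    omega
  have : Nonempty β := by
    obtain ⟨x, -⟩ : (L e).Nonempty := Finset.card_pos.1 (by have := hL e he; omega)
    exact ⟨x⟩
  obtain ⟨c, hc, hprop, hdist⟩ :=
    SimpleGraph.exists_partial_colouring L hΔ hiso hL G.edgeFinset subset_rfl
  refine ⟨c, hc, hprop, fun u v huv heq => ?_⟩
  have hsub : ∀ w, (G.incidenceFinset w).erase s(u, v) ⊆ G.edgeFinset := fun w e he =>
    (SimpleGraph.mem_incidenceFinset_iff.1 (Finset.mem_of_mem_erase he)).1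
  have huvE : s(u, v) ∈ G.edgeFinset := by simpa using huv
  have himage : ∀ w ∈ s(u, v), ((G.incidenceFinset w).erase s(u, v)).image c =
      ((G.incidenceFinset w).image c).erase (c s(u, v)) := by
    intro w hw
    have hw' : s(u, v) ∈ G.incidenceFinset w :=
      SimpleGraph.mem_incidenceFinset_iff.2 ⟨huvE, hw⟩
    conv_rhs => rw [← Finset.insert_erase hw', Finset.image_insert]
    rw [Finset.erase_insert]
    simp only [Finset.mem_image, Finset.mem_erase, SimpleGraph.mem_incidenceFinset_iff]
    rintro ⟨g, ⟨hne, hg, hwg⟩, hcg⟩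
    exact hprop g hg _ huvE hne ⟨w, hwg, hw⟩ hcg
  apply hdist u v huv (hsub u) (hsub v)
  rw [himage u (by simp), himage v (by simp), heq]
end
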